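/- arXiv:0707.1448 — 4 statements merged into one kernel-verified Lean document; each statement's English description precedes it below -/
import Mathlib

section
/- Fix α > 0 and an integer N ≥ 1. Let Φ : ℝ × ℝ^{2N} → ℝ^{2N} be the flow of the system a_n' = πn·b_n, b_n' = −πn·a_n − (πn)^{−1} χ_n ∫_Θ |w_a|^α w_a e_n (n = 1,…,N); that is, Φ(0,x) = x for all x and for every x the curve t ↦ Φ(t,x) is a global solution of the system. Then for every t ∈ ℝ the pushforward of the measure ρ_N under the map Φ(t,·) equals ρ_N. -/
open MeasureTheory Set ENNReal NNReal

noncomputable section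

/-- The ambient Euclidean space `ℝ³`. -/
abbrev E3 := EuclideanSpace ℝ (Fin 3)

/-- Lebesgue measure restricted to the unit ball `Θ` of `ℝ³`. -/
def μΘ : Measure E3 := volume.restrict (Metric.ball 0 1)

/-- The `L²`-normalized radial Dirichlet eigenfunctions
`e_n(x) = sin (nπ|x|) / (√(2π)|x|)` of the unit ball of `ℝ³`. -/
def eFun (n : ℕ) (x : E3) : ℝ :=
  Real.sin (n * Real.pi * ‖x‖) / (Real.sqrt (2 * Real.pi) * ‖x‖)

/-- The `H^σ(Θ)` norm of the radial function with coefficients `c`, i.e. of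
`u = ∑_{n ≥ 1} c_{n-1} e_n` : `‖u‖² = ∑_{n≥1} (πn)^{2σ} |c_{n-1}|²`. -/
def HNorm (σ : ℝ) (c : ℕ → ℂ) : ℝ≥0∞ :=
  (∑' n : ℕ, ENNReal.ofReal ((Real.pi * (n + 1)) ^ (2 * σ)) * (‖c n‖₊ : ℝ≥0∞) ^ 2) ^ (1/2 : ℝ)

/-- The radial function `∑_{n ≥ 1} c_{n-1} e_n` associated to a coefficient sequence. -/
def vFun (c : ℕ → ℂ) (x : E3) : ℂ := ∑' n : ℕ, c n * (eFun (n + 1) x : ℂ)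

/-- The free evolution `S(t) = e^{-it√(-Δ)}` acting on coefficient sequences:
the `n`-th coefficient is multiplied by `e^{-iπnt}`. -/
def Sc (t : ℝ) (c : ℕ → ℂ) (n : ℕ) : ℂ :=
  Complex.exp (-(Real.pi * (n + 1) * t) * Complex.I) * c n

/-- The mixed norm `‖f‖_{L^p((-T,T);L^q(Θ))}`. -/
def mixedNorm (p q : ℝ≥0∞) (T : ℝ) (f : ℝ → E3 → ℂ) : ℝ≥0∞ :=
  eLpNorm (fun t => (eLpNorm (f t) q μΘ).toReal) p (volume.restrict (Set.Ioo (-T) T))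

/-- The exponent `p_σ = 2/σ`. -/
def pSig (σ : ℝ) : ℝ≥0∞ := ENNReal.ofReal (2 / σ)

/-- The exponent `q_σ` with `1/p_σ + 1/q_σ = 1/2`, i.e. `q_σ = 2/(1-σ)`. -/
def qSig (σ : ℝ) : ℝ≥0∞ := ENNReal.ofReal (2 / (1 - σ))

/-- The `X^σ_T` norm: `sup_{|t| ≤ T} ‖v(t)‖_{H^σ} + ‖v‖_{L^{p_σ}((-T,T);L^{q_σ}(Θ))}`,
for a curve `v` of coefficient sequences. -/
def XNorm (σ : ℝ) (T : ℝ) (v : ℝ → ℕ → ℂ) : ℝ≥0∞ :=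
  (⨆ t ∈ Set.Icc (-T) T, HNorm σ (v t)) + mixedNorm (pSig σ) (qSig σ) T (fun t => vFun (v t))

/-- Membership in `X^σ_T = C([-T,T];H^σ(Θ)) ∩ L^{p_σ}((-T,T);L^{q_σ}(Θ))`:
continuity in `H^σ` on `[-T,T]` together with finiteness of the `X^σ_T` norm. -/
def MemX (σ T : ℝ) (v : ℝ → ℕ → ℂ) : Prop :=
  (∀ t ∈ Set.Icc (-T) T,
    Filter.Tendsto (fun s => HNorm σ (fun n => v s n - v t n))
      (nhdsWithin t (Set.Icc (-T) T)) (nhds 0)) ∧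
  XNorm σ T v < ⊤

/-- The coefficients of the Duhamel term `D(g)(t) = -i∫₀ᵗ S(t-τ) √(-Δ)⁻¹ g(τ) dτ`:
the `n`-th coefficient is `-i(πn)⁻¹ ∫₀ᵗ e^{-iπn(t-τ)} (∫_Θ g(τ,x) e_n(x) dx) dτ`. -/
def Dcoef (g : ℝ → E3 → ℂ) (t : ℝ) (n : ℕ) : ℂ :=
  -Complex.I * (Real.pi * (n + 1))⁻¹ *
    ∫ τ in (0:ℝ)..t, Complex.exp (-(Real.pi * (n + 1) * (t - τ)) * Complex.I) *
      ∫ x, g τ x * (eFun (n + 1) x : ℂ) ∂μΘ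

/-- The nonlinearity `F(z) = |Re z|^α Re z`. -/
def Fnl (α : ℝ) (z : ℂ) : ℝ := |z.re| ^ α * z.re

/-- The space-time norm `‖f‖_{L^p(S × Θ)}` (product Lebesgue measure). -/
def stLp (p : ℝ≥0∞) (S : Set ℝ) (f : ℝ → E3 → ℂ) : ℝ≥0∞ :=
  eLpNorm (fun z : ℝ × E3 => f z.1 z.2) p ((volume.restrict S).prod μΘ)


/-- The truncated radial function `w_a = ∑_{m=1}^N χ(m²/N²) a_m e_m`. -/
def wA {N : ℕ} (χ : ℝ → ℝ) (a : Fin N → ℝ) (x : E3) : ℝ :=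
  ∑ m : Fin N, χ (((m : ℕ) + 1 : ℝ) ^ 2 / (N : ℝ) ^ 2) * a m * eFun ((m : ℕ) + 1) x

/-- The Hamiltonian
`H(a,b) = (1/2) ∑_{n=1}^N (πn)²(a_n² + b_n²) + (1/(α+2)) ∫_Θ |w_a|^{α+2}`. -/
def Ham {N : ℕ} (χ : ℝ → ℝ) (α : ℝ) (ab : (Fin N → ℝ) × (Fin N → ℝ)) : ℝ :=
  (1/2) * ∑ n : Fin N, (Real.pi * ((n : ℕ) + 1)) ^ 2 * ((ab.1 n) ^ 2 + (ab.2 n) ^ 2)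
    + (1/(α + 2)) * ∫ x, |wA χ ab.1 x| ^ (α + 2) ∂μΘ

/-- The Gibbs-type measure `ρ_N` on `ℝ^N × ℝ^N = ℝ^{2N}` with density
`(2π)^{-N} (∏_{n=1}^N (πn)²) exp(-H(a,b))` with respect to Lebesgue measure. -/
def rhoN (N : ℕ) (χ : ℝ → ℝ) (α : ℝ) : Measure ((Fin N → ℝ) × (Fin N → ℝ)) :=
  volume.withDensity fun ab => ENNReal.ofReal
    (((2 * Real.pi) ^ N)⁻¹ * (∏ n : Fin N, (Real.pi * ((n : ℕ) + 1)) ^ 2) *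
      Real.exp (-(Ham χ α ab)))

/-! ### Symplectic Euler scheme -/

/-- One step of the symplectic Euler scheme for `a' = P b`, `b' = Q a`. -/
def seStep {V : Type*} [NormedAddCommGroup V] [NormedSpace ℝ V] (P Q : V → V) (h : ℝ)
    (z : V × V) : V × V :=
  (z.1 + h • P (z.2 + h • Q z.1), z.2 + h • Q z.1)

theorem se_taylor {V : Type*} [NormedAddCommGroup V] [NormedSpace ℝ V]
    (f : ℝ → V) (f' : ℝ → V) (hf : ∀ s, HasDerivAt f (f' s) s)
    (T C : ℝ) (s h r : ℝ) (hs : s ∈ Icc (-T) T) (hsh : s + h ∈ Icc (-T) T)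
    (hr : r ∈ uIcc s (s + h)) (hC0 : 0 ≤ C)
    (hC : ∀ u ∈ Icc (-T) T, ∀ v ∈ Icc (-T) T, ‖f' u - f' v‖ ≤ C * |u - v|) :
    ‖f (s + h) - f s - h • f' r‖ ≤ C * h ^ 2 := by
  have hsub : uIcc s (s + h) ⊆ Icc (-T) T := uIcc_subset_Icc hs hsh
  have key := Convex.norm_image_sub_le_of_norm_hasDerivWithin_le
    (f := fun u => f u - u • f' r) (f' := fun u => f' u - f' r) (s := uIcc s (s + h))
    (C := C * |h|) (x := s) (y := s + h) ?_ ?_ (convex_uIcc _ _) left_mem_uIcc right_mem_uIcc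
  · have e : f (s + h) - (s + h) • f' r - (f s - s • f' r) = f (s + h) - f s - h • f' r := by
      rw [add_smul]; abel
    simp only [e, add_sub_cancel_left, Real.norm_eq_abs] at key
    calc _ ≤ _ := key
      _ = C * h ^ 2 := by rw [mul_assoc, abs_mul_abs_self]; ring
  · intro u _
    have h1 := (hasDerivAt_id u).smul_const (f' r)
    have := ((hf u).sub h1).hasDerivWithinAt (s := uIcc s (s + h))
    rw [one_smul] at this
    exact this
  · intro u hu
    refine (hC u (hsub hu) r (hsub hr)).trans ?_
    have := abs_sub_le_of_uIcc_subset_uIcc (uIcc_subset_uIcc hr hu)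
    refine mul_le_mul_of_nonneg_left ?_ hC0
    simpa using this

theorem se_recursion (e : ℕ → ℝ) (c d : ℝ) (hc : 0 ≤ c) (hd : 0 ≤ d) (n : ℕ)
    (h0 : e 0 = 0) (h : ∀ k < n, e (k + 1) ≤ (1 + c) * e k + d) :
    ∀ k ≤ n, e k ≤ k * d * Real.exp (k * c) := by
  intro k
  induction k with
  | zero => intro _; simp [h0]
  | succ k ih =>
    intro hk
    have h1 := h k (by omega)
    have h2 := ih (by omega)
    have h3 : 1 + c ≤ Real.exp c := by linarith [Real.add_one_le_exp c]
    have h4 : Real.exp ((k + 1 : ℕ) * c) = Real.exp (k * c) * Real.exp c := by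
      rw [← Real.exp_add]; push_cast; ring_nf
    have h5 : 1 ≤ Real.exp ((k + 1 : ℕ) * c) := Real.one_le_exp (by positivity)
    calc e (k + 1) ≤ (1 + c) * e k + d := h1
      _ ≤ (1 + c) * (k * d * Real.exp (k * c)) + d := by gcongr
      _ ≤ Real.exp c * (k * d * Real.exp (k * c)) + d * Real.exp ((k + 1 : ℕ) * c) := by
          gcongr
          nlinarith
      _ = ((k + 1 : ℕ) : ℝ) * d * Real.exp ((k + 1 : ℕ) * c) := by rw [h4]; push_cast; ring

theorem se_tendsto {V : Type*} [NormedAddCommGroup V] [NormedSpace ℝ V]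
    (P Q : V → V) (L : ℝ) (hL : 0 ≤ L) (hP : ∀ x y, ‖P x - P y‖ ≤ L * ‖x - y‖)
    (hQ : ∀ x y, ‖Q x - Q y‖ ≤ L * ‖x - y‖)
    (a b : ℝ → V) (ha : ∀ s, HasDerivAt a (P (b s)) s) (hb : ∀ s, HasDerivAt b (Q (a s)) s)
    (t : ℝ) :
    Filter.Tendsto (fun n : ℕ => (seStep P Q (t / (n + 1 : ℝ)))^[n + 1] (a 0, b 0)) Filter.atTop
      (nhds (a t, b t)) := by
  have hac : Continuous a := continuous_iff_continuousAt.2 fun s => (ha s).continuousAt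
  have hbc : Continuous b := continuous_iff_continuousAt.2 fun s => (hb s).continuousAt
  have hPc : Continuous P := (LipschitzWith.of_dist_le_mul (K := ⟨L, hL⟩)
    (fun x y => by rw [dist_eq_norm, dist_eq_norm]; exact hP x y)).continuous
  have hQc : Continuous Q := (LipschitzWith.of_dist_le_mul (K := ⟨L, hL⟩)
    (fun x y => by rw [dist_eq_norm, dist_eq_norm]; exact hQ x y)).continuous
  set T := |t| with hT
  obtain ⟨M1, hM1⟩ := (isCompact_Icc (a := -T) (b := T)).exists_bound_of_continuousOn
    (hPc.comp hbc).continuousOn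
  obtain ⟨M2, hM2⟩ := (isCompact_Icc (a := -T) (b := T)).exists_bound_of_continuousOn
    (hQc.comp hac).continuousOn
  set M := max (max M1 M2) 0 with hM
  have hM0 : 0 ≤ M := le_max_right _ _
  have hLipa : ∀ u ∈ Icc (-T) T, ∀ v ∈ Icc (-T) T, ‖a u - a v‖ ≤ M * |u - v| := by
    intro u hu v hv
    exact Convex.norm_image_sub_le_of_norm_hasDerivWithin_le
      (fun x _ => (ha x).hasDerivWithinAt)
      (fun x hx => (hM1 x hx).trans ((le_max_left _ _).trans (le_max_left _ _)))
      (convex_Icc _ _) hv hu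
  have hLipb : ∀ u ∈ Icc (-T) T, ∀ v ∈ Icc (-T) T, ‖b u - b v‖ ≤ M * |u - v| := by
    intro u hu v hv
    exact Convex.norm_image_sub_le_of_norm_hasDerivWithin_le
      (fun x _ => (hb x).hasDerivWithinAt)
      (fun x hx => (hM2 x hx).trans ((le_max_right _ _).trans (le_max_left _ _)))
      (convex_Icc _ _) hv hu
  have hCa : ∀ u ∈ Icc (-T) T, ∀ v ∈ Icc (-T) T, ‖P (b u) - P (b v)‖ ≤ L * M * |u - v| := by
    intro u hu v hv
    refine (hP _ _).trans ?_
    rw [mul_assoc]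
    gcongr
    exact hLipb u hu v hv
  have hCb : ∀ u ∈ Icc (-T) T, ∀ v ∈ Icc (-T) T, ‖Q (a u) - Q (a v)‖ ≤ L * M * |u - v| := by
    intro u hu v hv
    refine (hQ _ _).trans ?_
    rw [mul_assoc]
    gcongr
    exact hLipa u hu v hv
  have hLM : 0 ≤ L * M := by positivity
  -- one-step error
  have step : ∀ (s h : ℝ) (z : V × V), s ∈ Icc (-T) T → s + h ∈ Icc (-T) T →
      ‖seStep P Q h z - (a (s + h), b (s + h))‖ ≤
        (1 + (|h| * L + h ^ 2 * L ^ 2)) * ‖z - (a s, b s)‖ + (1 + |h| * L) * (L * M * h ^ 2) := by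
    intro s h z hs hsh
    have ta := se_taylor a (fun s => P (b s)) ha T (L * M) s h (s + h) hs hsh right_mem_uIcc hLM hCa
    have tb := se_taylor b (fun s => Q (a s)) hb T (L * M) s h s hs hsh left_mem_uIcc hLM hCb
    set E := ‖z - (a s, b s)‖ with hE
    have e1 : ‖z.1 - a s‖ ≤ E := norm_fst_le (z - (a s, b s))
    have e2 : ‖z.2 - b s‖ ≤ E := norm_snd_le (z - (a s, b s))
    have hE0 : 0 ≤ E := norm_nonneg _
    have hq : ‖h • (Q z.1 - Q (a s))‖ ≤ |h| * L * E := by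
      rw [norm_smul, Real.norm_eq_abs, mul_assoc]
      gcongr
      exact (hQ _ _).trans (by gcongr)
    have eb : ‖z.2 + h • Q z.1 - b (s + h)‖ ≤ E + |h| * L * E + L * M * h ^ 2 := by
      have : z.2 + h • Q z.1 - b (s + h) = (z.2 - b s) + h • (Q z.1 - Q (a s))
          - (b (s + h) - b s - h • Q (a s)) := by
        rw [smul_sub]; abel
      rw [this]
      refine (norm_sub_le _ _).trans ?_
      refine add_le_add ((norm_add_le _ _).trans (add_le_add e2 hq)) tb
    have hp : ‖h • (P (z.2 + h • Q z.1) - P (b (s + h)))‖ ≤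
        |h| * L * (E + |h| * L * E + L * M * h ^ 2) := by
      rw [norm_smul, Real.norm_eq_abs, mul_assoc]
      gcongr
      exact (hP _ _).trans (by gcongr)
    have ea : ‖z.1 + h • P (z.2 + h • Q z.1) - a (s + h)‖ ≤
        E + |h| * L * (E + |h| * L * E + L * M * h ^ 2) + L * M * h ^ 2 := by
      have : z.1 + h • P (z.2 + h • Q z.1) - a (s + h) = (z.1 - a s)
          + h • (P (z.2 + h • Q z.1) - P (b (s + h)))
          - (a (s + h) - a s - h • P (b (s + h))) := by
        rw [smul_sub]; abel
      rw [this]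
      refine (norm_sub_le _ _).trans ?_
      refine add_le_add ((norm_add_le _ _).trans (add_le_add e1 hp)) ta
    have hh : |h| * |h| = h ^ 2 := by rw [abs_mul_abs_self]; ring
    refine norm_prod_le_iff.2 ⟨?_, ?_⟩
    · refine ea.trans (le_of_eq ?_)
      rw [← hh]; ring
    · refine eb.trans ?_
      have h1 : 0 ≤ h ^ 2 * L ^ 2 * E := by positivity
      have h2 : 0 ≤ |h| * L * (L * M * h ^ 2) := by positivity
      nlinarith
  -- global error
  have glob : ∀ n : ℕ, ‖(seStep P Q (t / (n + 1 : ℝ)))^[n + 1] (a 0, b 0) - (a t, b t)‖ ≤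
      (1 + T * L) * (L * M * T ^ 2) * Real.exp (T * L + T ^ 2 * L ^ 2) * (1 / ((n : ℝ) + 1)) := by
    intro n
    set h := t / (n + 1 : ℝ) with hh
    have hn : (0 : ℝ) < n + 1 := by positivity
    have habs : |h| = T / (n + 1) := by rw [hh, abs_div, abs_of_pos hn]
    have hT0 : 0 ≤ T := abs_nonneg _
    have hmem : ∀ k : ℕ, k ≤ n + 1 → (k : ℝ) * h ∈ Icc (-T) T := by
      intro k hk
      rw [mem_Icc, ← abs_le, abs_mul, habs, Nat.abs_cast]
      have : (k : ℝ) ≤ n + 1 := by exact_mod_cast hk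
      rw [← mul_div_assoc, div_le_iff₀ hn]
      nlinarith
    have rec' := se_recursion
      (fun k => ‖(seStep P Q h)^[k] (a 0, b 0) - (a (k * h), b (k * h))‖)
      (|h| * L + h ^ 2 * L ^ 2) ((1 + |h| * L) * (L * M * h ^ 2)) (by positivity) (by positivity)
      (n + 1) (by simp) (by
        intro k hk
        have h1 := hmem k hk.le
        have h2 := hmem (k + 1) hk
        have e : ((k + 1 : ℕ) : ℝ) * h = k * h + h := by push_cast; ring
        rw [e] at h2
        have := step (k * h) h ((seStep P Q h)^[k] (a 0, b 0)) h1 h2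
        simp only [Function.iterate_succ_apply', e]
        exact this) (n + 1) le_rfl
    have e : ((n + 1 : ℕ) : ℝ) * h = t := by rw [hh]; push_cast; field_simp
    simp only [e] at rec'
    refine rec'.trans ?_
    have hle : |h| ≤ T := by
      rw [habs]; exact div_le_self hT0 (by linarith [(Nat.cast_nonneg n : (0 : ℝ) ≤ n)])
    have hsq : h ^ 2 = T ^ 2 / (n + 1) ^ 2 := by rw [← sq_abs, habs, div_pow]
    have hexp : ((n + 1 : ℕ) : ℝ) * (|h| * L + h ^ 2 * L ^ 2) ≤ T * L + T ^ 2 * L ^ 2 := by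
      have e1 : ((n + 1 : ℕ) : ℝ) * |h| = T := by rw [habs]; push_cast; field_simp
      have e2 : ((n + 1 : ℕ) : ℝ) * h ^ 2 ≤ T ^ 2 := by
        rw [← sq_abs, sq, ← mul_assoc, e1, sq]; gcongr
      calc ((n + 1 : ℕ) : ℝ) * (|h| * L + h ^ 2 * L ^ 2)
          = ((n + 1 : ℕ) : ℝ) * |h| * L + ((n + 1 : ℕ) : ℝ) * h ^ 2 * L ^ 2 := by ring
        _ ≤ _ := by rw [e1]; gcongr
    have e3 : ((n + 1 : ℕ) : ℝ) * ((1 + |h| * L) * (L * M * h ^ 2)) =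
        (1 + |h| * L) * (L * M * T ^ 2) * (1 / ((n : ℝ) + 1)) := by
      rw [hsq]; push_cast; field_simp
    rw [e3]
    calc (1 + |h| * L) * (L * M * T ^ 2) * (1 / ((n : ℝ) + 1)) *
          Real.exp (((n + 1 : ℕ) : ℝ) * (|h| * L + h ^ 2 * L ^ 2))
        ≤ (1 + T * L) * (L * M * T ^ 2) * (1 / ((n : ℝ) + 1)) *
          Real.exp (T * L + T ^ 2 * L ^ 2) := by gcongr
      _ = _ := by ring
  rw [tendsto_iff_norm_sub_tendsto_zero]
  refine squeeze_zero (fun _ => norm_nonneg _) glob ?_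
  have := (tendsto_one_div_add_atTop_nhds_zero_nat (𝕜 := ℝ)).const_mul
    ((1 + T * L) * (L * M * T ^ 2) * Real.exp (T * L + T ^ 2 * L ^ 2))
  rw [mul_zero] at this
  exact this

theorem se_measurePreserving {N : ℕ} (P Q : (Fin N → ℝ) → (Fin N → ℝ))
    (hP : Continuous P) (hQ : Continuous Q) (h : ℝ) :
    MeasurePreserving (seStep P Q h) volume volume := by
  have shear : ∀ R : (Fin N → ℝ) → (Fin N → ℝ), Continuous R →
      MeasurePreserving (fun z : (Fin N → ℝ) × (Fin N → ℝ) => (z.1, z.2 + h • R z.1))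
        ((volume : Measure (Fin N → ℝ)).prod volume)
        ((volume : Measure (Fin N → ℝ)).prod volume) := by
    intro R hR
    refine (MeasurePreserving.id (volume : Measure (Fin N → ℝ))).skew_product
      (g := fun x y => y + h • R x) ?_ ?_
    · apply Continuous.measurable
      simp only [Function.uncurry_def]
      fun_prop
    · refine Filter.Eventually.of_forall fun x => ?_
      exact (measurePreserving_add_right volume (h • R x)).map_eq
  have sw : MeasurePreserving (Prod.swap : (Fin N → ℝ) × (Fin N → ℝ) → _)
      ((volume : Measure (Fin N → ℝ)).prod volume)
      ((volume : Measure (Fin N → ℝ)).prod volume) := Measure.measurePreserving_swap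
  have := ((sw.comp (shear P hP)).comp sw).comp (shear Q hQ)
  exact this

/-- Lower semicontinuity: limits of measure-preserving maps do not increase volume of open sets. -/
theorem limit_open_le {X : Type*} [TopologicalSpace X] [MeasurableSpace X] [BorelSpace X]
    (μ : Measure X) (S : ℕ → X → X) (hS : ∀ n, MeasurePreserving (S n) μ μ) (F : X → X)
    (K : Set X) (hlim : ∀ x ∈ K, Filter.Tendsto (fun n => S n x) Filter.atTop (nhds (F x)))
    (U : Set X) (hU : IsOpen U) : μ (K ∩ F ⁻¹' U) ≤ μ U := by
  have hsub : K ∩ F ⁻¹' U ⊆ ⋃ n : ℕ, ⋂ m ≥ n, S m ⁻¹' U := by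
    rintro x ⟨hxK, hxU⟩
    have := (hlim x hxK).eventually (hU.mem_nhds hxU)
    obtain ⟨n, hn⟩ := Filter.eventually_atTop.1 this
    simp only [mem_iUnion, mem_iInter]
    exact ⟨n, hn⟩
  refine (measure_mono hsub).trans ?_
  rw [Monotone.measure_iUnion]
  · refine iSup_le fun n => ?_
    refine (measure_mono (iInter₂_subset n le_rfl)).trans ?_
    exact ((hS n).measure_preimage hU.measurableSet.nullMeasurableSet).le
  · intro i j hij
    exact biInter_subset_biInter_left fun m hm => le_trans hij hm

/-- Liouville theorem for separable systems admitting a conserved quantity with Lipschitz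
truncations on sublevel sets. -/
theorem liouville_sep {N : ℕ}
    (Φ : ℝ → ((Fin N → ℝ) × (Fin N → ℝ)) → ((Fin N → ℝ) × (Fin N → ℝ)))
    (H : (Fin N → ℝ) × (Fin N → ℝ) → ℝ) (hHm : Measurable H)
    (P Q : (Fin N → ℝ) → (Fin N → ℝ))
    (hcons : ∀ t x, H (Φ t x) = H x) (hΦ0 : ∀ x, Φ 0 x = x)
    (hode1 : ∀ x t, HasDerivAt (fun s => (Φ s x).1) (P (Φ t x).2) t)
    (hode2 : ∀ x t, HasDerivAt (fun s => (Φ s x).2) (Q (Φ t x).1) t)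
    (htr : ∀ k : ℕ, ∃ (QR : (Fin N → ℝ) → (Fin N → ℝ)) (L : ℝ), 0 ≤ L ∧
      (∀ x y, ‖P x - P y‖ ≤ L * ‖x - y‖) ∧ (∀ x y, ‖QR x - QR y‖ ≤ L * ‖x - y‖) ∧
      ∀ z, H z ≤ k → QR z.1 = Q z.1) (t : ℝ) :
    MeasurePreserving (Φ t) volume volume := by
  choose QR L hL hP hQ hQR using htr
  have hPc : Continuous P := (LipschitzWith.of_dist_le_mul (K := ⟨L 0, hL 0⟩)
    (fun x y => by rw [dist_eq_norm, dist_eq_norm]; exact hP 0 x y)).continuous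
  have hQc : ∀ k, Continuous (QR k) := fun k => (LipschitzWith.of_dist_le_mul (K := ⟨L k, hL k⟩)
    (fun x y => by rw [dist_eq_norm, dist_eq_norm]; exact hQ k x y)).continuous
  set S : ℕ → ℝ → ℕ → (Fin N → ℝ) × (Fin N → ℝ) → (Fin N → ℝ) × (Fin N → ℝ) :=
    fun k t n => (seStep P (QR k) (t / (n + 1 : ℝ)))^[n + 1] with hS
  have hSmp : ∀ k t n, MeasurePreserving (S k t n) volume volume := fun k t n =>
    (se_measurePreserving P (QR k) hPc (hQc k) _).iterate _
  have hlim : ∀ (k : ℕ) (u t : ℝ) (x), H x ≤ k →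
      Filter.Tendsto (fun n => S k t n (Φ u x)) Filter.atTop (nhds (Φ (u + t) x)) := by
    intro k u t x hx
    have := se_tendsto P (QR k) (L k) (hL k) (hP k) (hQ k)
      (fun s => (Φ (u + s) x).1) (fun s => (Φ (u + s) x).2)
      (fun s => by
        simpa using HasDerivAt.comp_const_add u s (hode1 x (u + s)))
      (fun s => by
        rw [hQR k (Φ (u + s) x) (by rw [hcons]; exact hx)]
        simpa using HasDerivAt.comp_const_add u s (hode2 x (u + s))) t
    simp only [add_zero] at this
    exact this
  have hinv : ∀ t x, Φ (-t) (Φ t x) = x := by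
    intro t x
    obtain ⟨k, hk⟩ := exists_nat_ge (H x)
    have h1 := hlim k t (-t) x hk
    have h2 := hlim k 0 (-t) (Φ t x) (by rw [hcons]; exact hk)
    rw [hΦ0, zero_add] at h2
    rw [add_neg_cancel, hΦ0] at h1
    exact tendsto_nhds_unique h2 h1
  have hlim0 : ∀ (k : ℕ) (t : ℝ) (x), x ∈ {x | H x ≤ (k : ℝ)} →
      Filter.Tendsto (fun n => S k t n x) Filter.atTop (nhds (Φ t x)) := by
    intro k t x hx
    have := hlim k 0 t x hx
    rwa [hΦ0, zero_add] at this
  have hKm : ∀ k : ℕ, MeasurableSet {x | H x ≤ (k : ℝ)} := fun k =>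
    measurableSet_le hHm measurable_const
  have hmeas : ∀ t, Measurable (Φ t) := by
    intro t
    have h1 : ∀ k : ℕ, Measurable ({x | H x ≤ (k : ℝ)}.indicator (Φ t)) := by
      intro k
      refine measurable_of_tendsto_metrizable
        (f := fun n => {x | H x ≤ (k : ℝ)}.indicator (S k t n))
        (fun n => (hSmp k t n).measurable.indicator (hKm k)) ?_
      rw [tendsto_pi_nhds]
      intro x
      by_cases hx : x ∈ {x | H x ≤ (k : ℝ)}
      · simp only [indicator_of_mem hx]
        exact hlim0 k t x hx
      · simp only [indicator_of_notMem hx]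
        exact tendsto_const_nhds
    refine measurable_of_tendsto_metrizable h1 ?_
    rw [tendsto_pi_nhds]
    intro x
    obtain ⟨k, hk⟩ := exists_nat_ge (H x)
    refine tendsto_const_nhds.congr' ?_
    filter_upwards [Filter.eventually_ge_atTop k] with m hm
    have : x ∈ {x | H x ≤ (m : ℝ)} := hk.trans (by exact_mod_cast hm)
    rw [indicator_of_mem this]
  have hopen : ∀ t U, IsOpen U → volume (Φ t ⁻¹' U) ≤ volume U := by
    intro t U hU
    have e : Φ t ⁻¹' U = ⋃ k : ℕ, ({x | H x ≤ (k : ℝ)} ∩ Φ t ⁻¹' U) := by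
      ext x
      obtain ⟨k, hk⟩ := exists_nat_ge (H x)
      simp only [mem_iUnion, mem_inter_iff]
      exact ⟨fun h => ⟨k, hk, h⟩, fun ⟨_, _, h⟩ => h⟩
    rw [e, Monotone.measure_iUnion]
    · exact iSup_le fun k => limit_open_le volume (S k t) (hSmp k t) (Φ t) _ (hlim0 k t) U hU
    · intro i j hij
      refine inter_subset_inter_left _ fun x hx => ?_
      have hij' : (i : ℝ) ≤ j := by exact_mod_cast hij
      have hx' : H x ≤ i := hx
      exact hx'.trans hij'
  have hle : ∀ t A, volume (Φ t ⁻¹' A) ≤ volume A := by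
    intro t A
    rw [A.measure_eq_iInf_isOpen volume]
    refine le_iInf₂ fun U hAU => le_iInf fun hU => ?_
    exact (measure_mono (preimage_mono hAU)).trans (hopen t U hU)
  refine ⟨hmeas t, Measure.ext fun A hA => ?_⟩
  rw [Measure.map_apply (hmeas t) hA]
  refine le_antisymm (hle t A) ?_
  have e : A = Φ (-t) ⁻¹' (Φ t ⁻¹' A) := by
    ext x
    have := hinv (-t) x
    rw [neg_neg] at this
    simp [mem_preimage, this]
  calc volume A = volume (Φ (-t) ⁻¹' (Φ t ⁻¹' A)) := by rw [← e]
    _ ≤ _ := hle _ _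

theorem withDensity_inv {X : Type*} [MeasurableSpace X] (μ : Measure X) (F : X → X)
    (hF : MeasurePreserving F μ μ) (f : X → ℝ≥0∞) (hf : Measurable f) (hfF : ∀ x, f (F x) = f x) :
    Measure.map F (μ.withDensity f) = μ.withDensity f := by
  ext A hA
  rw [Measure.map_apply hF.measurable hA, withDensity_apply _ hA,
    withDensity_apply _ (hF.measurable hA), ← hF.setLIntegral_comp_preimage hA hf]
  simp only [hfF]

/-! ### Estimates for the nonlinear terms -/

theorem eFun_meas (n : ℕ) : Measurable (eFun n) := by
  unfold eFun
  exact Measurable.div (by fun_prop) (by fun_prop)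

theorem eFun_bound (n : ℕ) (x : E3) : |eFun n x| ≤ n * Real.pi := by
  unfold eFun
  rcases eq_or_ne ‖x‖ 0 with h | h
  · rw [h, mul_zero, mul_zero, _root_.div_zero, abs_zero]; positivity
  · have hx : 0 < ‖x‖ := lt_of_le_of_ne (norm_nonneg _) h.symm
    have h1 : 1 ≤ Real.sqrt (2 * Real.pi) := by
      rw [Real.one_le_sqrt]; linarith [Real.pi_gt_three]
    rw [abs_div, abs_of_pos (a := Real.sqrt (2 * Real.pi) * ‖x‖) (by positivity),
      div_le_iff₀ (by positivity)]
    have h2 : |Real.sin (n * Real.pi * ‖x‖)| ≤ n * Real.pi * ‖x‖ := by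
      have := Real.abs_sin_le_abs (x := n * Real.pi * ‖x‖)
      rwa [abs_of_nonneg (a := n * Real.pi * ‖x‖) (by positivity)] at this
    have h3 : 0 ≤ n * Real.pi * ‖x‖ := by positivity
    nlinarith

instance muTheta_finite : IsFiniteMeasure μΘ := by
  unfold μΘ
  exact ⟨by rw [Measure.restrict_apply_univ]; exact measure_ball_lt_top⟩

theorem wA_meas2 {N : ℕ} (χ : ℝ → ℝ) :
    Measurable (fun p : (Fin N → ℝ) × E3 => wA χ p.1 p.2) := by
  unfold wA
  refine Finset.measurable_sum _ fun m _ => ?_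
  refine Measurable.mul (by fun_prop) ((eFun_meas _).comp measurable_snd)

theorem wA_meas {N : ℕ} (χ : ℝ → ℝ) (a : Fin N → ℝ) : Measurable (wA χ a) :=
  (wA_meas2 χ).comp (measurable_const.prodMk measurable_id)

/-- A constant bounding `w_a` pointwise by the norm of `a`. -/
def wConst (N : ℕ) (χ : ℝ → ℝ) : ℝ :=
  ∑ m : Fin N, |χ (((m : ℕ) + 1 : ℝ) ^ 2 / (N : ℝ) ^ 2)| * (((m : ℕ) + 1 : ℕ) * Real.pi)

theorem wConst_nonneg (N : ℕ) (χ : ℝ → ℝ) : 0 ≤ wConst N χ := by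
  unfold wConst
  exact Finset.sum_nonneg fun m _ => by positivity

theorem wA_bound {N : ℕ} (χ : ℝ → ℝ) (a : Fin N → ℝ) (x : E3) :
    |wA χ a x| ≤ wConst N χ * ‖a‖ := by
  unfold wA wConst
  rw [Finset.sum_mul]
  refine (Finset.abs_sum_le_sum_abs _ _).trans (Finset.sum_le_sum fun m _ => ?_)
  rw [abs_mul, abs_mul]
  have h1 : |a m| ≤ ‖a‖ := norm_le_pi_norm a m
  have h2 := eFun_bound ((m : ℕ) + 1) x
  calc _ ≤ |χ (((m : ℕ) + 1 : ℝ) ^ 2 / (N : ℝ) ^ 2)| * ‖a‖ * ((((m : ℕ) + 1 : ℕ) : ℝ) * Real.pi) := by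
        gcongr
    _ = _ := by ring

theorem wA_sub {N : ℕ} (χ : ℝ → ℝ) (a b : Fin N → ℝ) (x : E3) :
    wA χ a x - wA χ b x = wA χ (a - b) x := by
  unfold wA
  rw [← Finset.sum_sub_distrib]
  refine Finset.sum_congr rfl fun m _ => ?_
  simp only [Pi.sub_apply]; ring

theorem psi_deriv (α : ℝ) (hα : 0 < α) (x : ℝ) :
    HasDerivAt (fun z : ℝ => |z| ^ α * z) ((α + 1) * |x| ^ α) x := by
  rcases eq_or_ne x 0 with rfl | hx
  · rw [hasDerivAt_iff_tendsto_slope]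
    simp only [abs_zero, Real.zero_rpow hα.ne', mul_zero]
    have h1 : Filter.Tendsto (fun z : ℝ => |z| ^ α) (nhdsWithin 0 {0}ᶜ) (nhds 0) := by
      have : Continuous (fun z : ℝ => |z| ^ α) := continuous_abs.rpow_const fun _ => Or.inr hα.le
      have := this.tendsto 0
      simp only [abs_zero, Real.zero_rpow hα.ne'] at this
      exact this.mono_left nhdsWithin_le_nhds
    refine h1.congr' ?_
    filter_upwards [self_mem_nhdsWithin] with z hz
    have hz : z ≠ 0 := hz
    simp [slope_def_field, hz]
  · have h1 : HasDerivAt (fun z : ℝ => |z|) (SignType.sign x : ℝ) x := hasDerivAt_abs hx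
    have h2 := (h1.rpow_const (p := α) (Or.inl (abs_pos.2 hx).ne')).mul (hasDerivAt_id x)
    convert! h2 using 1
    have h3 : |x| ^ α = |x| ^ (α - 1) * |x| := by
      rw [← Real.rpow_add_one (abs_pos.2 hx).ne']; ring_nf
    have h4 : (SignType.sign x : ℝ) * x = |x| := by
      rw [mul_comm]; exact self_mul_sign x
    simp only [id, mul_one]
    rw [h3]
    linear_combination (-α * |x| ^ (α - 1)) * h4

theorem psi_lip (α : ℝ) (hα : 0 < α) (M x y : ℝ) (hx : |x| ≤ M) (hy : |y| ≤ M) :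
    |(|x| ^ α * x) - (|y| ^ α * y)| ≤ (α + 1) * M ^ α * |x - y| := by
  refine Convex.norm_image_sub_le_of_norm_hasDerivWithin_le (s := Icc (-M) M)
    (fun z _ => (psi_deriv α hα z).hasDerivWithinAt) ?_ (convex_Icc _ _) (abs_le.1 hy) (abs_le.1 hx)
  intro z hz
  have : |z| ≤ M := abs_le.2 hz
  rw [Real.norm_eq_abs, abs_of_nonneg (by positivity)]
  gcongr

theorem psi_bound (α : ℝ) (hα : 0 < α) (M x : ℝ) (hx : |x| ≤ M) :
    |(|x| ^ α * x)| ≤ M ^ α * M := by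
  have : 0 ≤ M := (abs_nonneg x).trans hx
  rw [abs_mul, abs_of_nonneg (a := |x| ^ α) (by positivity)]
  gcongr

theorem psi_wA_meas {N : ℕ} (α : ℝ) (χ : ℝ → ℝ) (a : Fin N → ℝ) :
    Measurable (fun y => |wA χ a y| ^ α * wA χ a y) :=
  Measurable.mul ((wA_meas χ a).abs.pow_const α) (wA_meas χ a)

theorem psi_int {N : ℕ} (α : ℝ) (hα : 0 < α) (χ : ℝ → ℝ) (a : Fin N → ℝ) (n : ℕ) :
    Integrable (fun y => |wA χ a y| ^ α * wA χ a y * eFun n y) μΘ := by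
  refine Integrable.of_bound ((psi_wA_meas α χ a).mul (eFun_meas n)).aestronglyMeasurable
    ((wConst N χ * ‖a‖) ^ α * (wConst N χ * ‖a‖) * (n * Real.pi))
    (Filter.Eventually.of_forall fun y => ?_)
  have h0 := wConst_nonneg N χ
  rw [norm_mul]
  exact mul_le_mul (psi_bound α hα _ _ (wA_bound χ a y)) (eFun_bound n y) (norm_nonneg _)
    (by positivity)

/-- The `n`-th nonlinear coefficient. -/
def nlCoef {N : ℕ} (α : ℝ) (χ : ℝ → ℝ) (n : ℕ) (a : Fin N → ℝ) : ℝ :=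
  ∫ y, |wA χ a y| ^ α * wA χ a y * eFun n y ∂μΘ

theorem nlCoef_lip {N : ℕ} (α : ℝ) (hα : 0 < α) (χ : ℝ → ℝ) (n : ℕ) (R : ℝ) (hR : 0 ≤ R) :
    ∃ C : ℝ, 0 ≤ C ∧ ∀ a b : Fin N → ℝ, ‖a‖ ≤ R → ‖b‖ ≤ R →
      |nlCoef α χ n a - nlCoef α χ n b| ≤ C * ‖a - b‖ := by
  have h0 := wConst_nonneg N χ
  refine ⟨(α + 1) * (wConst N χ * R) ^ α * wConst N χ * (n * Real.pi) * μΘ.real univ,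
    by positivity, fun a b ha hb => ?_⟩
  unfold nlCoef
  rw [← integral_sub (psi_int α hα χ a n) (psi_int α hα χ b n), ← Real.norm_eq_abs]
  refine le_trans (norm_integral_le_of_norm_le_const (μ := μΘ) (C := (α + 1) * (wConst N χ * R) ^ α * wConst N χ
    * (n * Real.pi) * ‖a - b‖) (Filter.Eventually.of_forall fun y => ?_)) ?_
  swap
  · apply le_of_eq; ring
  rw [← sub_mul, norm_mul]
  have h1 := psi_lip α hα (wConst N χ * R) (wA χ a y) (wA χ b y)
    ((wA_bound χ a y).trans (by gcongr)) ((wA_bound χ b y).trans (by gcongr))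
  rw [wA_sub] at h1
  have h2 := wA_bound χ (a - b) y
  calc _ ≤ ((α + 1) * (wConst N χ * R) ^ α * (wConst N χ * ‖a - b‖)) * (n * Real.pi) := by
        refine mul_le_mul (h1.trans ?_) (eFun_bound n y) (norm_nonneg _) (by positivity)
        gcongr
    _ = _ := by ring

theorem pot_deriv {N : ℕ} (α : ℝ) (hα : 0 < α) (χ : ℝ → ℝ) (a a' : ℝ → Fin N → ℝ)
    (ha : ∀ s n, HasDerivAt (fun u => a u n) (a' s n) s) (hac : Continuous a)
    (ha' : Continuous a') (t : ℝ) :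
    HasDerivAt (fun s => ∫ y, |wA χ (a s) y| ^ (α + 2) ∂μΘ)
      (∫ y, (α + 2) * (|wA χ (a t) y| ^ α * wA χ (a t) y) * wA χ (a' t) y ∂μΘ) t := by
  have h0 := wConst_nonneg N χ
  obtain ⟨M1, hM1⟩ := (isCompact_closedBall t 1).exists_bound_of_continuousOn hac.continuousOn
  obtain ⟨M2, hM2⟩ := (isCompact_closedBall t 1).exists_bound_of_continuousOn ha'.continuousOn
  have h1 : 0 ≤ M1 := (norm_nonneg _).trans (hM1 t (by simp))
  have h2 : 0 ≤ M2 := (norm_nonneg _).trans (hM2 t (by simp))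
  refine (hasDerivAt_integral_of_dominated_loc_of_deriv_le
    (F := fun s y => |wA χ (a s) y| ^ (α + 2))
    (F' := fun s y => (α + 2) * (|wA χ (a s) y| ^ α * wA χ (a s) y) * wA χ (a' s) y)
    (bound := fun _ => (α + 2) * ((wConst N χ * M1) ^ α * (wConst N χ * M1)) * (wConst N χ * M2))
    (s := Metric.closedBall t 1) (Metric.closedBall_mem_nhds t one_pos) ?_ ?_ ?_ ?_
    (integrable_const _) ?_).2
  · exact Filter.Eventually.of_forall fun s =>
      ((wA_meas χ (a s)).abs.pow_const _).aestronglyMeasurable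
  · refine Integrable.of_bound ((wA_meas χ (a t)).abs.pow_const _).aestronglyMeasurable
      ((wConst N χ * ‖a t‖) ^ (α + 2)) (Filter.Eventually.of_forall fun y => ?_)
    rw [Real.norm_eq_abs, abs_of_nonneg (by positivity)]
    have := wA_bound χ (a t) y
    gcongr
  · exact (((psi_wA_meas α χ (a t)).const_mul _).mul (wA_meas χ (a' t))).aestronglyMeasurable
  · refine Filter.Eventually.of_forall fun y s hs => ?_
    rw [norm_mul, norm_mul, Real.norm_eq_abs (α + 2), abs_of_pos (a := α + 2) (by linarith)]
    have b1 : |wA χ (a s) y| ≤ wConst N χ * M1 :=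
      (wA_bound χ (a s) y).trans (by gcongr; exact hM1 s hs)
    have b2 : |wA χ (a' s) y| ≤ wConst N χ * M2 :=
      (wA_bound χ (a' s) y).trans (by gcongr; exact hM2 s hs)
    have b3 := psi_bound α hα _ _ b1
    refine mul_le_mul (mul_le_mul_of_nonneg_left b3 (by linarith)) b2 (norm_nonneg _)
      (by positivity)
  · refine Filter.Eventually.of_forall fun y s _ => ?_
    have d1 : HasDerivAt (fun u => wA χ (a u) y) (wA χ (a' s) y) s := by
      unfold wA
      refine HasDerivAt.fun_sum fun m _ => ?_
      exact ((ha s m).const_mul _).mul_const _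
    have d2 := (hasDerivAt_abs_rpow (wA χ (a s) y) (p := α + 2) (by linarith)).comp s d1
    convert! d2 using 1
    rw [add_sub_cancel_right]; ring

theorem pot_deriv_sum {N : ℕ} (α : ℝ) (hα : 0 < α) (χ : ℝ → ℝ) (a v : Fin N → ℝ) :
    ∫ y, (α + 2) * (|wA χ a y| ^ α * wA χ a y) * wA χ v y ∂μΘ =
      (α + 2) * ∑ m : Fin N, χ (((m : ℕ) + 1 : ℝ) ^ 2 / (N : ℝ) ^ 2) * v m *
        nlCoef α χ ((m : ℕ) + 1) a := by
  have e : ∀ y, (α + 2) * (|wA χ a y| ^ α * wA χ a y) * wA χ v y =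
      (α + 2) * ∑ m : Fin N, χ (((m : ℕ) + 1 : ℝ) ^ 2 / (N : ℝ) ^ 2) * v m *
        (|wA χ a y| ^ α * wA χ a y * eFun ((m : ℕ) + 1) y) := by
    intro y
    conv_lhs => rw [show wA χ v y = ∑ m : Fin N, χ (((m : ℕ) + 1 : ℝ) ^ 2 / (N : ℝ) ^ 2) * v m *
      eFun ((m : ℕ) + 1) y from rfl]
    rw [mul_assoc, Finset.mul_sum]
    congr 1
    refine Finset.sum_congr rfl fun m _ => ?_
    ring
  simp only [e]
  rw [integral_const_mul, integral_finsetSum _ fun m _ => (psi_int α hα χ a _).const_mul _]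
  simp only [integral_const_mul]
  rfl

theorem Ham_meas {N : ℕ} (χ : ℝ → ℝ) (α : ℝ) :
    Measurable (Ham χ α : (Fin N → ℝ) × (Fin N → ℝ) → ℝ) := by
  unfold Ham
  refine Measurable.add ?_ (Measurable.const_mul ?_ _)
  · fun_prop
  · have h1 : StronglyMeasurable
        (fun p : (Fin N → ℝ) × E3 => |wA χ p.1 p.2| ^ (α + 2)) :=
      ((wA_meas2 χ).abs.pow_const _).stronglyMeasurable
    have h2 : StronglyMeasurable (fun a : Fin N → ℝ => ∫ x, |wA χ a x| ^ (α + 2) ∂μΘ) :=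
      h1.integral_prod_right (ν := μΘ)
    exact h2.measurable.comp measurable_fst

theorem Ham_coord_bound {N : ℕ} (χ : ℝ → ℝ) (α : ℝ) (hα : 0 < α)
    (z : (Fin N → ℝ) × (Fin N → ℝ)) (E : ℝ) (hz : Ham χ α z ≤ E) (hE : 0 ≤ E) (n : Fin N) :
    |z.1 n| ≤ E + 1 := by
  unfold Ham at hz
  have h1 : 0 ≤ (1/(α + 2)) * ∫ x, |wA χ z.1 x| ^ (α + 2) ∂μΘ := by
    refine mul_nonneg (by positivity) (integral_nonneg fun x => by positivity)
  have h2 := Finset.single_le_sum (s := Finset.univ)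
    (f := fun n : Fin N => (Real.pi * ((n : ℕ) + 1)) ^ 2 * ((z.1 n) ^ 2 + (z.2 n) ^ 2))
    (fun i _ => by positivity) (Finset.mem_univ n)
  have h3 : 2 * (z.1 n) ^ 2 ≤ (Real.pi * ((n : ℕ) + 1)) ^ 2 * ((z.1 n) ^ 2 + (z.2 n) ^ 2) := by
    have : 3 ≤ Real.pi * ((n : ℕ) + 1) := by
      nlinarith [Real.pi_gt_three, (Nat.cast_nonneg (n : ℕ) : (0 : ℝ) ≤ (n : ℕ))]
    have : 2 ≤ (Real.pi * ((n : ℕ) + 1)) ^ 2 := by nlinarith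
    nlinarith [sq_nonneg (z.1 n), sq_nonneg (z.2 n)]
  have h4 : (z.1 n) ^ 2 ≤ E := by linarith
  exact abs_le_of_sq_le_sq (by nlinarith) (by linarith)

/-- Coordinatewise clamp to `[-R, R]`. -/
def clampR {N : ℕ} (R : ℝ) (a : Fin N → ℝ) (n : Fin N) : ℝ := max (-R) (min R (a n))

theorem clampR_norm {N : ℕ} (R : ℝ) (hR : 0 ≤ R) (a : Fin N → ℝ) : ‖clampR R a‖ ≤ R := by
  rw [pi_norm_le_iff_of_nonneg hR]
  intro n
  rw [Real.norm_eq_abs, abs_le]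
  exact ⟨le_max_left _ _, max_le (by linarith) (min_le_left _ _)⟩

theorem clampR_lip {N : ℕ} (R : ℝ) (a b : Fin N → ℝ) :
    ‖clampR R a - clampR R b‖ ≤ ‖a - b‖ := by
  rw [pi_norm_le_iff_of_nonneg (norm_nonneg _)]
  intro n
  have h1 : |max (-R) (min R (a n)) - max (-R) (min R (b n))| ≤ |min R (a n) - min R (b n)| := by
    simpa using abs_max_sub_max_le_max (-R) (min R (a n)) (-R) (min R (b n))
  have h2 : |min R (a n) - min R (b n)| ≤ |a n - b n| := by
    simpa using abs_min_sub_min_le_max R (a n) R (b n)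
  exact (h1.trans h2).trans (norm_le_pi_norm (a - b) n)

theorem clampR_eq {N : ℕ} (R : ℝ) (a : Fin N → ℝ) (h : ∀ n, |a n| ≤ R) : clampR R a = a := by
  funext n
  obtain ⟨h1, h2⟩ := abs_le.1 (h n)
  unfold clampR
  rw [min_eq_right h2, max_eq_right h1]

/-- The linear part of the vector field. -/
def vfP (N : ℕ) (b : Fin N → ℝ) (n : Fin N) : ℝ := Real.pi * ((n : ℕ) + 1) * b n

/-- The nonlinear part of the vector field. -/
def vfQ {N : ℕ} (α : ℝ) (χ : ℝ → ℝ) (a : Fin N → ℝ) (n : Fin N) : ℝ :=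
  -(Real.pi * ((n : ℕ) + 1)) * a n
    - (Real.pi * ((n : ℕ) + 1))⁻¹ * χ (((n : ℕ) + 1 : ℝ) ^ 2 / (N : ℝ) ^ 2) *
      nlCoef α χ ((n : ℕ) + 1) a

theorem vf_trunc {N : ℕ} (α : ℝ) (hα : 0 < α) (χ : ℝ → ℝ) (k : ℕ) :
    ∃ (QR : (Fin N → ℝ) → (Fin N → ℝ)) (L : ℝ), 0 ≤ L ∧
      (∀ x y, ‖vfP N x - vfP N y‖ ≤ L * ‖x - y‖) ∧ (∀ x y, ‖QR x - QR y‖ ≤ L * ‖x - y‖) ∧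
      ∀ z : (Fin N → ℝ) × (Fin N → ℝ), Ham χ α z ≤ k → QR z.1 = vfQ α χ z.1 := by
  have hR : (0 : ℝ) ≤ (k : ℝ) + 1 := by positivity
  choose C hC0 hC using fun n : Fin N =>
    nlCoef_lip (N := N) α hα χ ((n : ℕ) + 1) ((k : ℝ) + 1) hR
  set D : Fin N → ℝ := fun n => Real.pi * ((n : ℕ) + 1) +
    |(Real.pi * ((n : ℕ) + 1))⁻¹ * χ (((n : ℕ) + 1 : ℝ) ^ 2 / (N : ℝ) ^ 2)| * C n with hD
  have hp : ∀ n : Fin N, 0 ≤ Real.pi * ((n : ℕ) + 1) := fun n => by positivity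
  have hq : ∀ n : Fin N,
      0 ≤ |(Real.pi * ((n : ℕ) + 1))⁻¹ * χ (((n : ℕ) + 1 : ℝ) ^ 2 / (N : ℝ) ^ 2)| * C n :=
    fun n => mul_nonneg (abs_nonneg _) (hC0 n)
  have hD0 : ∀ n, 0 ≤ D n := fun n => add_nonneg (hp n) (hq n)
  have hDL : ∀ n, D n ≤ ∑ m, D m := fun n =>
    Finset.single_le_sum (fun i _ => hD0 i) (Finset.mem_univ n)
  have hL : 0 ≤ ∑ m, D m := Finset.sum_nonneg fun i _ => hD0 i
  refine ⟨fun a => vfQ α χ (clampR ((k : ℝ) + 1) a), ∑ m, D m, hL, ?_, ?_, ?_⟩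
  · intro x y
    rw [pi_norm_le_iff_of_nonneg (by positivity)]
    intro n
    have h1 : |x n - y n| ≤ ‖x - y‖ := norm_le_pi_norm (x - y) n
    simp only [Pi.sub_apply, vfP]
    rw [← mul_sub, Real.norm_eq_abs, abs_mul, abs_of_nonneg (hp n)]
    refine mul_le_mul ?_ h1 (abs_nonneg _) hL
    exact (le_add_of_nonneg_right (hq n)).trans (hDL n)
  · intro x y
    rw [pi_norm_le_iff_of_nonneg (by positivity)]
    intro n
    set x' := clampR ((k : ℝ) + 1) x
    set y' := clampR ((k : ℝ) + 1) y
    have h0 : ‖x' - y'‖ ≤ ‖x - y‖ := clampR_lip _ x y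
    have h1 : |x' n - y' n| ≤ ‖x' - y'‖ := norm_le_pi_norm (x' - y') n
    have h2 := hC n x' y' (clampR_norm _ hR _) (clampR_norm _ hR _)
    simp only [Pi.sub_apply, vfQ]
    have e : ∀ p c u v i j : ℝ, -p * u - c * i - (-p * v - c * j) = -(p * (u - v) + c * (i - j)) := by
      intros; ring
    rw [e, norm_neg]
    refine (norm_add_le _ _).trans ?_
    rw [norm_mul (Real.pi * _), norm_mul (_ * χ _), Real.norm_eq_abs (Real.pi * _),
      abs_of_nonneg (hp n)]
    calc _ ≤ Real.pi * ((n : ℕ) + 1) * ‖x' - y'‖ +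
          |(Real.pi * ((n : ℕ) + 1))⁻¹ * χ (((n : ℕ) + 1 : ℝ) ^ 2 / (N : ℝ) ^ 2)| *
            (C n * ‖x' - y'‖) :=
          add_le_add (mul_le_mul_of_nonneg_left h1 (hp n))
            (mul_le_mul_of_nonneg_left h2 (abs_nonneg _))
      _ = D n * ‖x' - y'‖ := by rw [hD]; ring
      _ ≤ _ := mul_le_mul (hDL n) h0 (norm_nonneg _) hL
  · intro z hz
    have := clampR_eq ((k : ℝ) + 1) z.1 fun n => Ham_coord_bound χ α hα z k hz (by positivity) n
    simp only [this]

/-- the measure `ρ_N` is invariant under the flow `Φ` of the truncated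
Hamiltonian ODE system. -/
theorem stmt2 (α : ℝ) (hα : 0 < α) (N : ℕ) (hN : 1 ≤ N)
    (χ : ℝ → ℝ) (hχ_smooth : ContDiff ℝ (⊤ : ℕ∞) χ)
    (hχ_supp : Function.support χ ⊆ Set.Ioo (-1) 1)
    (hχ_one : Set.EqOn χ 1 (Set.Ioo (-(1/2)) (1/2)))
    (Φ : ℝ → ((Fin N → ℝ) × (Fin N → ℝ)) → ((Fin N → ℝ) × (Fin N → ℝ)))
    (hΦ0 : ∀ x, Φ 0 x = x)
    (hΦode : ∀ x : (Fin N → ℝ) × (Fin N → ℝ), ∀ t : ℝ, ∀ n : Fin N,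
      HasDerivAt (fun s => (Φ s x).1 n) (Real.pi * ((n : ℕ) + 1) * (Φ t x).2 n) t ∧
      HasDerivAt (fun s => (Φ s x).2 n)
        (-(Real.pi * ((n : ℕ) + 1)) * (Φ t x).1 n
          - (Real.pi * ((n : ℕ) + 1))⁻¹ * χ (((n : ℕ) + 1 : ℝ) ^ 2 / (N : ℝ) ^ 2) *
            ∫ y, |wA χ (Φ t x).1 y| ^ α * wA χ (Φ t x).1 y * eFun ((n : ℕ) + 1) y ∂μΘ) t) :
    ∀ t : ℝ, Measure.map (Φ t) (rhoN N χ α) = rhoN N χ α := by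
  have h1 : ∀ x t, HasDerivAt (fun s => (Φ s x).1) (vfP N (Φ t x).2) t := fun x t =>
    hasDerivAt_pi.2 fun n => (hΦode x t n).1
  have h2 : ∀ x t, HasDerivAt (fun s => (Φ s x).2) (vfQ α χ (Φ t x).1) t := fun x t =>
    hasDerivAt_pi.2 fun n => (hΦode x t n).2
  have hcons : ∀ t x, Ham χ α (Φ t x) = Ham χ α x := by
    intro t x
    have c1 : Continuous fun s => (Φ s x).1 :=
      continuous_iff_continuousAt.2 fun s => (h1 x s).continuousAt
    have c2 : Continuous fun s => (Φ s x).2 :=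
      continuous_iff_continuousAt.2 fun s => (h2 x s).continuousAt
    have c3 : Continuous fun s => vfP N (Φ s x).2 := by
      refine continuous_pi fun n => ?_
      exact continuous_const.mul ((continuous_apply n).comp c2)
    have hd : ∀ s, HasDerivAt (fun s => Ham χ α (Φ s x)) 0 s := by
      intro s
      have p1 := pot_deriv α hα χ (fun s => (Φ s x).1) (fun s => vfP N (Φ s x).2)
        (fun s n => (hΦode x s n).1) c1 c3 s
      rw [pot_deriv_sum α hα] at p1
      have p2 : HasDerivAt (fun s => ∑ n : Fin N, (Real.pi * ((n : ℕ) + 1)) ^ 2 *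
          (((Φ s x).1 n) ^ 2 + ((Φ s x).2 n) ^ 2))
          (∑ n : Fin N, (Real.pi * ((n : ℕ) + 1)) ^ 2 *
            (2 * (Φ s x).1 n * vfP N (Φ s x).2 n + 2 * (Φ s x).2 n * vfQ α χ (Φ s x).1 n)) s := by
        refine HasDerivAt.fun_sum fun n _ => HasDerivAt.const_mul _ ?_
        have q1 := ((hΦode x s n).1).fun_pow 2
        have q2 := ((hΦode x s n).2).fun_pow 2
        convert! q1.add q2 using 1
        simp [vfP, vfQ, nlCoef]
      have p3 := (p2.const_mul (1/2)).add (p1.const_mul (1/(α + 2)))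
      convert! p3 using 1
      rw [← mul_assoc, one_div_mul_cancel (by linarith : α + 2 ≠ 0), one_mul, Finset.mul_sum,
        ← Finset.sum_add_distrib]
      symm
      refine Finset.sum_eq_zero fun n _ => ?_
      have : Real.pi * ((n : ℕ) + 1) ≠ 0 := by positivity
      simp only [vfP, vfQ]
      field_simp
      ring
    have hconst := is_const_of_deriv_eq_zero (f := fun s => Ham χ α (Φ s x))
      (fun s => (hd s).differentiableAt) (fun s => (hd s).deriv) t 0
    simpa [hΦ0] using hconst
  intro t
  refine withDensity_inv volume (Φ t)
    (liouville_sep Φ (Ham χ α) (Ham_meas χ α) (vfP N) (vfQ α χ) hcons hΦ0 h1 h2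
      (vf_trunc α hα χ) t) _ ?_ ?_
  · have := Ham_meas (N := N) χ α
    fun_prop
  · intro x
    rw [hcons]

end
end

section
/- For every p ∈ (3, ∞] there exists a constant C > 0 such that for all integers n ≥ 1, ‖e_n‖_{L^p(Θ)} ≤ C n^{1−3/p} (interpreted as C·n when p = ∞). Moreover, for every p ∈ [2,3) there exists C > 0 such that ‖e_n‖_{L^p(Θ)} ≤ C for all n ≥ 1. -/
open MeasureTheory Set ENNReal NNReal

noncomputable section

lemma aux_ge_one : 1 ≤ Real.sqrt (2 * Real.pi) := by
  rw [Real.one_le_sqrt]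
  linarith [Real.pi_gt_three]

lemma aux_bound1 (n : ℕ) (x : E3) : ‖eFun n x‖ ≤ ‖‖x‖⁻¹‖ := by
  unfold eFun
  rw [norm_div, norm_inv, Real.norm_eq_abs, Real.norm_eq_abs, norm_norm, abs_mul, abs_norm,
    abs_of_nonneg (Real.sqrt_nonneg _)]
  rcases eq_or_lt_of_le (norm_nonneg x) with h | h
  · simp [← h]
  · rw [inv_eq_one_div, div_le_div_iff₀ (by have := aux_ge_one; positivity) h]
    have h1 := Real.abs_sin_le_one (n * Real.pi * ‖x‖)
    nlinarith [aux_ge_one]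

lemma aux_bound2 (n : ℕ) (x : E3) :
    ‖eFun n x‖ ≤ (5 * n) * ‖(1 + ‖(n : ℝ) • x‖)⁻¹‖ := by
  unfold eFun
  rw [norm_div, Real.norm_eq_abs, Real.norm_eq_abs, norm_smul, abs_mul, abs_norm,
    abs_of_nonneg (Real.sqrt_nonneg _), norm_inv, Real.norm_natCast, Real.norm_eq_abs,
    abs_of_nonneg (by positivity : 0 ≤ 1 + n * ‖x‖)]
  rcases eq_or_lt_of_le (norm_nonneg x) with h | h
  · simp [← h]
  · rw [← div_eq_mul_inv, div_le_div_iff₀ (by have := aux_ge_one; positivity) (by positivity)]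
    have h1 := Real.abs_sin_le_one (n * Real.pi * ‖x‖)
    have h2 : |Real.sin (n * Real.pi * ‖x‖)| ≤ n * Real.pi * ‖x‖ := by
      refine Real.abs_sin_le_abs.trans_eq (abs_of_nonneg (by positivity))
    have h3 : (0:ℝ) ≤ n * ‖x‖ := by positivity
    calc |Real.sin (n * Real.pi * ‖x‖)| * (1 + n * ‖x‖)
        ≤ n * Real.pi * ‖x‖ + n * ‖x‖ := by nlinarith
      _ ≤ 5 * (n * ‖x‖) := by nlinarith [Real.pi_le_four]
      _ ≤ 5 * n * (Real.sqrt (2 * Real.pi) * ‖x‖) := by nlinarith [aux_ge_one]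

lemma aux_memG (p : ℝ≥0∞) (hp : 3 < p) :
    eLpNorm (fun y : E3 => (1 + ‖y‖)⁻¹) p volume ≠ ⊤ := by
  rcases eq_or_ne p ⊤ with rfl | hpt
  · refine ((eLpNorm_le_of_ae_bound (C := 1) (ae_of_all _ fun x => ?_)).trans_lt ?_).ne
    · rw [norm_inv, Real.norm_eq_abs, abs_of_nonneg (by positivity)]
      exact inv_le_one_of_one_le₀ (by linarith [norm_nonneg x])
    · simp
  · have hp0 : p ≠ 0 := (bot_lt_of_lt hp).ne'
    have h3 : (3:ℝ) < p.toReal := by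
      have := (ENNReal.toReal_lt_toReal (by simp) hpt).2 hp
      simpa using this
    refine (eLpNorm_lt_top_iff_lintegral_rpow_enorm_lt_top hp0 hpt).2 ?_ |>.ne
    have := finite_integral_one_add_norm (μ := (volume : Measure E3)) (r := p.toReal)
      (by simpa using h3)
    convert this using 3 with x
    rw [← ofReal_norm, ENNReal.ofReal_rpow_of_nonneg (norm_nonneg _) (by linarith),
      norm_inv, Real.norm_eq_abs, abs_of_nonneg (by positivity), Real.inv_rpow (by positivity),
      Real.rpow_neg (by positivity)]

lemma aux_memH (p : ℝ≥0∞) (hp2 : 2 ≤ p) (hp : p < 3) :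
    eLpNorm (fun y : E3 => ‖y‖⁻¹) p μΘ ≠ ⊤ := by
  have hpt : p ≠ ⊤ := (hp.trans_le le_top).ne
  have hp0 : p ≠ 0 := (lt_of_lt_of_le (by simp) hp2).ne'
  have h3 : p.toReal < 3 := by
    have := (ENNReal.toReal_lt_toReal hpt (by simp)).2 hp
    simpa using this
  refine (eLpNorm_lt_top_iff_lintegral_rpow_enorm_lt_top hp0 hpt).2 ?_ |>.ne
  have h : IntegrableOn (fun x : E3 => (fun r : ℝ => r ^ (-p.toReal)) ‖x‖) (Metric.ball 0 1)
      volume := by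
    refine (integrableOn_fun_norm_addHaar (E := E3) volume
      (f := fun r : ℝ => r ^ (-p.toReal))).2 ?_
    have := (intervalIntegral.integrableOn_Ioo_rpow_iff (s := 2 - p.toReal) one_pos).2
      (by linarith)
    refine this.congr_fun (fun y hy => ?_) measurableSet_Ioo
    simp only [finrank_euclideanSpace, Fintype.card_fin, smul_eq_mul]
    rw [sub_eq_add_neg, Real.rpow_add hy.1]
    norm_num
  refine lt_of_eq_of_lt (lintegral_congr fun x => ?_) h.2
  rw [← ofReal_norm, ← ofReal_norm,
    ENNReal.ofReal_rpow_of_nonneg (norm_nonneg _) (by positivity),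
    norm_inv, norm_norm, Real.norm_eq_abs, abs_of_nonneg (by positivity),
    Real.inv_rpow (by positivity), ← Real.rpow_neg (by positivity)]

/-- eigenfunction bounds `‖e_n‖_{L^p(Θ)} ≤ C n^{1-3/p}` for `p ∈ (3,∞]`
(with `n^{1-3/p}` read as `n` for `p = ∞`, i.e. `1 - 3/p.toReal` with `p.toReal = 0`),
and `‖e_n‖_{L^p(Θ)} ≤ C` for `p ∈ [2,3)`. -/
theorem stmt8 :
    (∀ p : ℝ≥0∞, 3 < p → ∃ C : ℝ, 0 < C ∧ ∀ n : ℕ, 1 ≤ n →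
      eLpNorm (eFun n) p μΘ ≤ ENNReal.ofReal (C * (n : ℝ) ^ (1 - 3 / p.toReal))) ∧
    (∀ p : ℝ≥0∞, 2 ≤ p → p < 3 → ∃ C : ℝ, 0 < C ∧ ∀ n : ℕ, 1 ≤ n →
      eLpNorm (eFun n) p μΘ ≤ ENNReal.ofReal C) := by
  constructor
  · intro p hp
    set K := eLpNorm (fun y : E3 => (1 + ‖y‖)⁻¹) p volume with hK
    have hKt : K ≠ ⊤ := aux_memG p hp
    refine ⟨5 * (K.toReal + 1), by positivity, fun n hn => ?_⟩
    have hn0 : (0:ℝ) < n := by exact_mod_cast hn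
    have hc : ENNReal.ofReal |((n:ℝ) ^ Module.finrank ℝ E3)⁻¹| ≠ 0 := by
      simp only [ne_eq, ENNReal.ofReal_eq_zero, not_le]
      positivity
    have hscale : eLpNorm (fun y : E3 => (1 + ‖(n:ℝ) • y‖)⁻¹) p volume
        = ENNReal.ofReal ((n:ℝ) ^ (-(3 / p.toReal))) * K := by
      have h1 := eLpNorm_map_measure (μ := (volume : Measure E3)) (p := p)
        (f := fun x : E3 => (n:ℝ) • x) (g := fun y : E3 => (1 + ‖y‖)⁻¹)
        (Measurable.aestronglyMeasurable (by fun_prop)) (by fun_prop)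
      rw [Measure.map_addHaar_smul _ hn0.ne', eLpNorm_smul_measure_of_ne_zero hc] at h1
      change _ = eLpNorm (fun y : E3 => (1 + ‖(n:ℝ) • y‖)⁻¹) p volume at h1
      rw [← h1, smul_eq_mul, ENNReal.ofReal_rpow_of_pos (by positivity),
        abs_of_pos (by positivity)]
      congr 2
      rw [finrank_euclideanSpace, Fintype.card_fin, ← Real.rpow_natCast, ← Real.rpow_neg hn0.le,
        ← Real.rpow_mul hn0.le]
      congr 1
      rw [ENNReal.toReal_div]
      simp
      ring
    calc eLpNorm (eFun n) p μΘ ≤ eLpNorm (eFun n) p volume :=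
          eLpNorm_mono_measure _ Measure.restrict_le_self
      _ ≤ ENNReal.ofReal (5 * n) * eLpNorm (fun y : E3 => (1 + ‖(n:ℝ) • y‖)⁻¹) p volume :=
          eLpNorm_le_mul_eLpNorm_of_ae_le_mul (ae_of_all _ fun x => aux_bound2 n x) p
      _ = ENNReal.ofReal (5 * n * (n:ℝ) ^ (-(3 / p.toReal)) * K.toReal) := by
          rw [hscale, ENNReal.ofReal_mul (q := K.toReal) (by positivity),
            ENNReal.ofReal_mul (p := 5 * n) (by positivity), ENNReal.ofReal_toReal hKt, mul_assoc]
      _ ≤ _ := by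
          apply ENNReal.ofReal_le_ofReal
          rw [sub_eq_add_neg, Real.rpow_add hn0, Real.rpow_one]
          have : 0 ≤ (n:ℝ) * (n:ℝ) ^ (-(3 / p.toReal)) := by positivity
          nlinarith
  · intro p hp2 hp
    have hKt := aux_memH p hp2 hp
    refine ⟨(eLpNorm (fun y : E3 => ‖y‖⁻¹) p μΘ).toReal + 1, by positivity, fun n hn => ?_⟩
    calc eLpNorm (eFun n) p μΘ ≤ eLpNorm (fun y : E3 => ‖y‖⁻¹) p μΘ :=
          eLpNorm_mono (aux_bound1 n)
      _ = ENNReal.ofReal (eLpNorm (fun y : E3 => ‖y‖⁻¹) p μΘ).toReal :=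
          (ENNReal.ofReal_toReal hKt).symm
      _ ≤ _ := ENNReal.ofReal_le_ofReal (by linarith)
end
end

section
/- Let 0 < σ < 1. There exists a constant C > 0 such that for every T ∈ (0,1] and every radial f ∈ H^σ(Θ), ‖S(·)f‖_{X^σ_T} ≤ C ‖f‖_{H^σ(Θ)}; in particular ‖S(t)f‖_{L^{p_σ}((−T,T); L^{q_σ}(Θ))} ≤ C ‖f‖_{H^σ(Θ)}, where p_σ = 2/σ and 1/p_σ + 1/q_σ = 1/2. -/
open MeasureTheory Set ENNReal NNReal

noncomputable section

/-- Truncated centred Hardy-Littlewood maximal function (rational radii at most `6`). -/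
def avgMax (f : ℝ → ℝ≥0∞) (x : ℝ) : ℝ≥0∞ :=
  ⨆ q : ℚ, ⨆ (_ : 0 < q ∧ q ≤ 6),
    (ENNReal.ofReal (2 * (q : ℝ)))⁻¹ * ∫⁻ y in Metric.ball x (q : ℝ), f y

lemma measurable_ballInt (f : ℝ → ℝ≥0∞) (hf : Measurable f) (q : ℝ) :
    Measurable (fun x => ∫⁻ y in Metric.ball x q, f y) := by
  have h1 : (fun x => ∫⁻ y in Metric.ball x q, f y) =
      fun x => ∫⁻ y, ({p : ℝ × ℝ | dist p.2 p.1 < q}.indicator (fun p => f p.2)) (x, y) := by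
    funext x
    rw [← lintegral_indicator measurableSet_ball]
    rfl
  rw [h1]
  apply Measurable.lintegral_prod_right'
  apply (hf.comp measurable_snd).indicator
  exact measurableSet_lt (by fun_prop) measurable_const

lemma measurable_avgMax (f : ℝ → ℝ≥0∞) (hf : Measurable f) : Measurable (avgMax f) := by
  unfold avgMax
  refine Measurable.iSup fun q => Measurable.iSup fun _ => ?_
  exact (measurable_ballInt f hf _).const_mul _

lemma avgMax_weak (f : ℝ → ℝ≥0∞) (hf : Measurable f) (a : ℝ≥0∞) :
    a * volume {x | a < avgMax f x} ≤ 4 * ∫⁻ y, f y := by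
  have hx : ∀ x : {x | a < avgMax f x}, ∃ q : ℚ, (0 < q ∧ q ≤ 6) ∧
      a * ENNReal.ofReal (2 * (q : ℝ)) ≤ ∫⁻ y in Metric.ball (x : ℝ) (q : ℝ), f y := by
    rintro ⟨x, hx⟩
    simp only [avgMax, mem_ofPred_eq, lt_iSup_iff] at hx
    obtain ⟨q, hq, h⟩ := hx
    refine ⟨q, hq, ?_⟩
    have hq0 : (0 : ℝ) < 2 * q := by have : (0 : ℝ) < q := by exact_mod_cast hq.1
                                     positivity
    have h2 : ENNReal.ofReal (2 * (q : ℝ)) ≠ 0 := by simpa using hq0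
    have h3 : ENNReal.ofReal (2 * (q : ℝ)) * a ≤ ENNReal.ofReal (2 * (q : ℝ)) *
        ((ENNReal.ofReal (2 * (q : ℝ)))⁻¹ * ∫⁻ y in Metric.ball x (q : ℝ), f y) := by
      gcongr
    rw [← mul_assoc, ENNReal.mul_inv_cancel h2 ENNReal.ofReal_ne_top, one_mul] at h3
    rw [mul_comm]
    exact h3
  choose r hr hav using hx
  obtain ⟨u, -, hdisj, hcov⟩ := Vitali.exists_disjoint_subfamily_covering_enlargement_ball
    (univ : Set {x | a < avgMax f x}) (fun x => (x : ℝ)) (fun x => (r x : ℝ)) 6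
    (fun x _ => by exact_mod_cast (hr x).2) 4 (by norm_num)
  have hr0 : ∀ x, (0 : ℝ) < r x := fun x => by exact_mod_cast (hr x).1
  have hcount : u.Countable := by
    apply hdisj.countable_of_isOpen (fun i _ => Metric.isOpen_ball)
    intro i _
    exact ⟨_, Metric.mem_ball_self (hr0 i)⟩
  have hsub : {x | a < avgMax f x} ⊆ ⋃ b ∈ u, Metric.ball (b : ℝ) (4 * r b) := by
    intro x hx
    obtain ⟨b, hb, hb2⟩ := hcov ⟨x, hx⟩ (mem_univ _)
    exact mem_biUnion hb (hb2 (Metric.mem_ball_self (hr0 _)))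
  calc a * volume {x | a < avgMax f x}
      ≤ a * ∑' b : u, volume (Metric.ball ((b : {x | a < avgMax f x}) : ℝ) (4 * r b)) := by
        gcongr
        exact (measure_mono hsub).trans (measure_biUnion_le _ hcount _)
    _ = ∑' b : u, 4 * (a * ENNReal.ofReal (2 * (r b : ℝ))) := by
        rw [← ENNReal.tsum_mul_left]
        congr 1; funext b
        rw [Real.volume_ball, show 2 * (4 * (r b : ℝ)) = 4 * (2 * r b) by ring,
          ENNReal.ofReal_mul (by norm_num)]
        norm_num
        ring
    _ ≤ ∑' b : u, 4 * ∫⁻ y in Metric.ball ((b : {x | a < avgMax f x}) : ℝ) (r b : ℝ), f y := by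
        gcongr with b
        exact hav _
    _ = 4 * ∫⁻ y in ⋃ b ∈ u, Metric.ball (b : ℝ) (r b : ℝ), f y := by
        rw [ENNReal.tsum_mul_left, lintegral_biUnion hcount (fun _ _ => measurableSet_ball) hdisj]
    _ ≤ 4 * ∫⁻ y, f y := by
        exact mul_le_mul_right (setLIntegral_le_lintegral _ _) _

lemma avgMax_le_of_le (f g : ℝ → ℝ≥0∞) (K : ℝ≥0∞) (hg : Measurable g) (h : ∀ x, f x ≤ g x + K)
    (x : ℝ) : avgMax f x ≤ avgMax g x + K := by
  unfold avgMax
  refine iSup_le fun q => iSup_le fun hq => ?_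
  have hq0 : (0 : ℝ) < 2 * q := by have : (0 : ℝ) < q := by exact_mod_cast hq.1
                                   positivity
  have h2 : ENNReal.ofReal (2 * (q : ℝ)) ≠ 0 := by simpa using hq0
  calc (ENNReal.ofReal (2 * (q : ℝ)))⁻¹ * ∫⁻ y in Metric.ball x (q : ℝ), f y
      ≤ (ENNReal.ofReal (2 * (q : ℝ)))⁻¹ * ∫⁻ y in Metric.ball x (q : ℝ), (g y + K) := by
        gcongr; exact h _
    _ = (ENNReal.ofReal (2 * (q : ℝ)))⁻¹ * (∫⁻ y in Metric.ball x (q : ℝ), g y) + K := by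
        rw [lintegral_add_left hg, setLIntegral_const, Real.volume_ball, mul_add, mul_comm K,
          ← mul_assoc, ENNReal.inv_mul_cancel h2 ENNReal.ofReal_ne_top, one_mul]
    _ ≤ _ := by
        gcongr
        exact le_iSup₂_of_le q hq le_rfl

lemma avgMax_bdd (f : ℝ → ℝ≥0∞) (K : ℝ≥0∞) (h : ∀ x, f x ≤ K)
    (x : ℝ) : avgMax f x ≤ K := by
  have := avgMax_le_of_le f (fun _ => 0) K measurable_const (by simpa using h) x
  simpa [avgMax] using this

lemma avgMax_strong (f : ℝ → ℝ≥0∞) (hf : Measurable f) (K : ℝ≥0) (hK : ∀ x, f x ≤ K) :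
    ∫⁻ x, (avgMax f x) ^ 2 ≤ 32 * ∫⁻ y, (f y) ^ 2 := by
  have hfin : ∀ x, avgMax f x ≠ ⊤ := fun x =>
    ne_top_of_le_ne_top ENNReal.coe_ne_top (avgMax_bdd f K hK x)
  have hff : ∀ x, f x ≠ ⊤ := fun x => ne_top_of_le_ne_top ENNReal.coe_ne_top (hK x)
  have hlc := lintegral_rpow_eq_lintegral_meas_lt_mul (volume : Measure ℝ)
    (f := fun x => (avgMax f x).toReal) (Filter.Eventually.of_forall fun x => ENNReal.toReal_nonneg)
    (measurable_avgMax f hf).ennreal_toReal.aemeasurable (p := 2) (by norm_num)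
  have e1 : ∀ x, ENNReal.ofReal ((avgMax f x).toReal ^ (2 : ℝ)) = (avgMax f x) ^ 2 := by
    intro x
    rw [Real.rpow_two, ENNReal.ofReal_pow ENNReal.toReal_nonneg, ENNReal.ofReal_toReal (hfin x)]
  simp only [e1] at hlc
  rw [hlc]
  have e2 : ∀ a ∈ Ioi (0 : ℝ), volume {x | a < (avgMax f x).toReal} * ENNReal.ofReal (a ^ ((2 : ℝ) - 1))
      ≤ 8 * ∫⁻ y, ({p : ℝ × ℝ | p.1 < 2 * (f p.2).toReal}.indicator (fun p => f p.2)) (a, y) := by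
    intro a ha
    have ha : 0 < a := ha
    set f1 : ℝ → ℝ≥0∞ := fun y => ({p : ℝ × ℝ | p.1 < 2 * (f p.2).toReal}.indicator (fun p => f p.2)) (a, y)
      with hf1
    have hf1m : Measurable f1 := by
      have : f1 = {y | a < 2 * (f y).toReal}.indicator f := by
        funext y; rfl
      rw [this]
      exact hf.indicator (measurableSet_lt measurable_const (hf.ennreal_toReal.const_mul _))
    have hle : ∀ x, f x ≤ f1 x + ENNReal.ofReal (a / 2) := by
      intro x
      by_cases hx : a < 2 * (f x).toReal
      · have : f1 x = f x := by simp [hf1, indicator, hx]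
        rw [this]; exact le_self_add
      · apply le_add_left
        rw [← ENNReal.ofReal_toReal (hff x)]
        apply ENNReal.ofReal_le_ofReal
        linarith
    have hsub : {x | a < (avgMax f x).toReal} ⊆ {x | ENNReal.ofReal (a / 2) < avgMax f1 x} := by
      intro x hx
      have h1 : ENNReal.ofReal a < avgMax f x := (ENNReal.ofReal_lt_iff_lt_toReal ha.le (hfin x)).2 hx
      have h2 := h1.trans_le (avgMax_le_of_le f f1 _ hf1m hle x)
      by_contra hcon
      simp only [mem_ofPred_eq, not_lt] at hcon
      have h3 : avgMax f1 x + ENNReal.ofReal (a / 2) ≤ ENNReal.ofReal a := by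
        calc _ ≤ ENNReal.ofReal (a / 2) + ENNReal.ofReal (a / 2) := by gcongr
          _ = ENNReal.ofReal a := by
            rw [← ENNReal.ofReal_add (by positivity) (by positivity)]; congr 1; ring
      exact absurd h2 (not_lt.2 h3)
    have hw := avgMax_weak f1 hf1m (ENNReal.ofReal (a / 2))
    calc volume {x | a < (avgMax f x).toReal} * ENNReal.ofReal (a ^ ((2 : ℝ) - 1))
        ≤ volume {x | ENNReal.ofReal (a / 2) < avgMax f1 x} * ENNReal.ofReal a := by
          gcongr
          norm_num
      _ = 2 * (ENNReal.ofReal (a / 2) * volume {x | ENNReal.ofReal (a / 2) < avgMax f1 x}) := by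
          rw [show a = 2 * (a / 2) by ring, ENNReal.ofReal_mul (by norm_num)]
          norm_num
          ring
      _ ≤ 2 * (4 * ∫⁻ y, f1 y) := by gcongr
      _ = 8 * ∫⁻ y, f1 y := by rw [← mul_assoc]; norm_num
  have hmeas2 : Measurable ({p : ℝ × ℝ | p.1 < 2 * (f p.2).toReal}.indicator (fun p => f p.2)) := by
    apply (hf.comp measurable_snd).indicator
    exact measurableSet_lt measurable_fst (((hf.comp measurable_snd).ennreal_toReal).const_mul _)
  calc ENNReal.ofReal 2 * ∫⁻ a in Ioi 0, volume {x | a < (avgMax f x).toReal} * ENNReal.ofReal (a ^ ((2 : ℝ) - 1))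
      ≤ 2 * ∫⁻ a in Ioi 0, 8 * ∫⁻ y, ({p : ℝ × ℝ | p.1 < 2 * (f p.2).toReal}.indicator (fun p => f p.2)) (a, y) := by
        gcongr ?_ * ?_
        · simp
        · exact setLIntegral_mono' measurableSet_Ioi e2
    _ = 16 * ∫⁻ y, ∫⁻ a in Ioi 0, ({p : ℝ × ℝ | p.1 < 2 * (f p.2).toReal}.indicator (fun p => f p.2)) (a, y) := by
        rw [lintegral_const_mul _ hmeas2.lintegral_prod_right', ← mul_assoc]
        rw [lintegral_lintegral_swap (f := fun a y =>
          ({p : ℝ × ℝ | p.1 < 2 * (f p.2).toReal}.indicator (fun p => f p.2)) (a, y))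
          hmeas2.aemeasurable]
        norm_num
    _ = 16 * ∫⁻ y, 2 * (f y) ^ 2 := by
        congr 2; funext y
        have : (fun a => ({p : ℝ × ℝ | p.1 < 2 * (f p.2).toReal}.indicator (fun p => f p.2)) (a, y))
            = (Iio (2 * (f y).toReal)).indicator (fun _ => f y) := by
          funext a; rfl
        rw [this, lintegral_indicator measurableSet_Iio, Measure.restrict_restrict measurableSet_Iio,
          setLIntegral_const, Iio_inter_Ioi, Real.volume_Ioo, sub_zero,
          ENNReal.ofReal_mul (by norm_num), ENNReal.ofReal_toReal (hff y)]
        norm_num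
        ring
    _ = 32 * ∫⁻ y, (f y) ^ 2 := by
        rw [lintegral_const_mul _ (hf.pow_const 2), ← mul_assoc]; norm_num


/-- Trigonometric polynomial with frequencies `π (n+1)`, `n < N`. -/
def tp (N : ℕ) (g : ℕ → ℂ) (s : ℝ) : ℂ :=
  ∑ n ∈ Finset.range N, g n * Complex.exp (-(Real.pi * (n + 1) * s) * Complex.I)

lemma continuous_tp (N : ℕ) (g : ℕ → ℂ) : Continuous (tp N g) := by
  unfold tp
  fun_prop

/-- frequency -/
def fr (n : ℕ) : ℝ := Real.pi * (n + 1)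

lemma fr_pos (n : ℕ) : 0 < fr n := by unfold fr; positivity

lemma exp_int (n : ℕ) (s l : ℝ) (hl : 0 < l) :
    ∫ y in (s - l)..(s + l), Complex.exp (-(Real.pi * (n + 1) * y) * Complex.I) =
      2 * l * (Real.sinc (fr n * l) * Complex.exp (-(Real.pi * (n + 1) * s) * Complex.I)) := by
  have hw : (fr n : ℂ) ≠ 0 := by exact_mod_cast (fr_pos n).ne'
  have hl' : (l : ℂ) ≠ 0 := by exact_mod_cast hl.ne'
  have hc : (-(fr n : ℂ) * Complex.I) ≠ 0 := mul_ne_zero (neg_ne_zero.2 hw) Complex.I_ne_zero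
  have h1 := integral_exp_mul_complex (a := s - l) (b := s + l) hc
  have h2 : ∀ y : ℝ, Complex.exp (-(Real.pi * (n + 1) * y) * Complex.I) =
      Complex.exp (-(fr n : ℂ) * Complex.I * y) := by
    intro y; congr 1; unfold fr; push_cast; ring
  simp only [h2]
  rw [h1, Real.sinc_of_ne_zero (mul_pos (fr_pos n) hl).ne']
  push_cast
  rw [Complex.sin]
  have e1 : Complex.exp (-(fr n : ℂ) * Complex.I * (s + l)) =
    Complex.exp (-(fr n : ℂ) * Complex.I * s) * Complex.exp (-((fr n : ℂ) * l) * Complex.I) := by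
    rw [← Complex.exp_add]; congr 1; ring
  have e2 : Complex.exp (-(fr n : ℂ) * Complex.I * (s - l)) =
    Complex.exp (-(fr n : ℂ) * Complex.I * s) * Complex.exp (((fr n : ℂ) * l) * Complex.I) := by
    rw [← Complex.exp_add]; congr 1; ring
  rw [e1, e2]
  generalize Complex.exp (-(fr n : ℂ) * Complex.I * s) = X
  generalize Complex.exp (-((fr n : ℂ) * l) * Complex.I) = Y
  generalize Complex.exp (((fr n : ℂ) * l) * Complex.I) = Z
  generalize (fr n : ℂ) = w at *
  rw [div_eq_iff hc]
  field_simp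
  linear_combination (X * (Y - Z)) * Complex.I_sq

lemma tp_int (N : ℕ) (g : ℕ → ℂ) (s l : ℝ) (hl : 0 < l) :
    ∫ y in (s - l)..(s + l), tp N g y =
      2 * l * tp N (fun n => g n * Real.sinc (fr n * l)) s := by
  unfold tp
  rw [intervalIntegral.integral_finsetSum]
  · rw [Finset.mul_sum]
    refine Finset.sum_congr rfl fun n _ => ?_
    rw [intervalIntegral.integral_const_mul, exp_int n s l hl]
    ring
  · intro n _
    apply Continuous.intervalIntegrable
    fun_prop

/-- local mass -/
def J (N : ℕ) (g : ℕ → ℂ) (t ρ : ℝ) : ℝ := ∫ y in (t - ρ)..(t + ρ), ‖tp N g y‖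

lemma J_mono (N : ℕ) (g : ℕ → ℂ) (t ρ t' ρ' : ℝ) (hρ : 0 ≤ ρ) (h1 : t' - ρ' ≤ t - ρ)
    (h2 : t + ρ ≤ t' + ρ') : J N g t ρ ≤ J N g t' ρ' := by
  unfold J
  apply intervalIntegral.integral_mono_interval h1 (by linarith) h2
  · exact Filter.Eventually.of_forall fun y => norm_nonneg _
  · exact ((continuous_tp N g).norm).intervalIntegrable _ _

/-- first average -/
abbrev Bg (l : ℝ) (g : ℕ → ℂ) : ℕ → ℂ := fun n => g n * Real.sinc (fr n * l)

lemma Bg_bound (N : ℕ) (g : ℕ → ℂ) (t l ρ y : ℝ) (hl : 0 < l) (hy : |y - t| + l ≤ ρ) :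
    ‖tp N (Bg l g) y‖ ≤ (2 * l)⁻¹ * J N g t ρ := by
  have h := tp_int N g y l hl
  have h1 : ‖∫ z in (y - l)..(y + l), tp N g z‖ ≤ J N g y l := by
    apply intervalIntegral.norm_integral_le_integral_norm (by linarith)
  rw [h] at h1
  have h2 : J N g y l ≤ J N g t ρ := by
    have := abs_le.1 (show |y - t| ≤ ρ - l by linarith)
    apply J_mono _ _ _ _ _ _ hl.le <;> linarith
  have h3 : ‖2 * (l : ℂ) * tp N (Bg l g) y‖ = 2 * l * ‖tp N (Bg l g) y‖ := by
    simp [abs_of_pos hl]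
  rw [h3] at h1
  rw [inv_mul_eq_div, le_div_iff₀ (by positivity)]
  linarith

lemma Ag_bound (N : ℕ) (g : ℕ → ℂ) (t l ρ s : ℝ) (hl : 0 < l) (hy : |s - t| + 2 * l ≤ ρ) :
    ‖tp N (Bg l (Bg l g)) s‖ ≤ (2 * l)⁻¹ * J N g t ρ := by
  have h := tp_int N (Bg l g) s l hl
  have h1 : ‖∫ z in (s - l)..(s + l), tp N (Bg l g) z‖ ≤ ((2 * l)⁻¹ * J N g t ρ) * |s + l - (s - l)| := by
    apply intervalIntegral.norm_integral_le_of_norm_le_const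
    intro z hz
    rw [uIoc_of_le (by linarith)] at hz
    apply Bg_bound _ _ _ _ _ _ hl
    have : |z - t| ≤ |z - s| + |s - t| := abs_sub_le _ _ _
    have : |z - s| ≤ l := abs_le.2 ⟨by linarith [hz.1], by linarith [hz.2]⟩
    linarith
  rw [h] at h1
  have h3 : ‖2 * (l : ℂ) * tp N (Bg l (Bg l g)) s‖ = 2 * l * ‖tp N (Bg l (Bg l g)) s‖ := by
    simp [abs_of_pos hl]
  rw [h3, show s + l - (s - l) = 2 * l by ring, abs_of_pos (by positivity), mul_comm] at h1
  exact le_of_mul_le_mul_right h1 (by positivity)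

lemma D_bound (N : ℕ) (g : ℕ → ℂ) (t r l m hp hm : ℝ) (hr : 0 < r) (hr1 : r ≤ 1) (hl : 0 < l)
    (hl1 : l ≤ 1) (Hm : ∀ ρ, 0 < ρ → ρ ≤ 3 → J N g t ρ ≤ 4 * ρ * m)
    (Hp : ∀ ρ, 0 < ρ → ρ ≤ 3 → J N g (t + r) ρ ≤ 4 * ρ * hp)
    (Hn : ∀ ρ, 0 < ρ → ρ ≤ 3 → J N g (t - r) ρ ≤ 4 * ρ * hm) :
    ‖tp N (Bg l (Bg l g)) (t + r) - tp N (Bg l (Bg l g)) (t - r)‖ ≤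
      12 * min (hp + hm) (r * m / l) := by
  have hi : (2 * l)⁻¹ * (2 * l) = 1 := inv_mul_cancel₀ (by positivity)
  have hi0 : 0 < (2 * l)⁻¹ := by positivity
  have J0 : ∀ t ρ, 0 < ρ → 0 ≤ J N g t ρ := fun t ρ h =>
    intervalIntegral.integral_nonneg (by linarith) fun _ _ => norm_nonneg _
  rw [mul_min_of_nonneg _ _ (by norm_num)]
  apply le_min
  · have a1 := Ag_bound N g (t + r) l (2 * l) (t + r) hl (by simp)
    have a2 := Ag_bound N g (t - r) l (2 * l) (t - r) hl (by simp)
    have b1 := Hp (2 * l) (by positivity) (by linarith)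
    have b2 := Hn (2 * l) (by positivity) (by linarith)
    have c1 : (2 * l)⁻¹ * J N g (t + r) (2 * l) ≤ 4 * hp := by
      calc _ ≤ (2 * l)⁻¹ * (4 * (2 * l) * hp) := by gcongr
        _ = 4 * hp * ((2 * l)⁻¹ * (2 * l)) := by ring
        _ = _ := by rw [hi]; ring
    have c2 : (2 * l)⁻¹ * J N g (t - r) (2 * l) ≤ 4 * hm := by
      calc _ ≤ (2 * l)⁻¹ * (4 * (2 * l) * hm) := by gcongr
        _ = 4 * hm * ((2 * l)⁻¹ * (2 * l)) := by ring
        _ = _ := by rw [hi]; ring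
    have hp0 : 0 ≤ hp := by
      have := (J0 (t + r) (2 * l) (by positivity)).trans b1
      by_contra hcon
      push Not at hcon
      nlinarith
    have hm0 : 0 ≤ hm := by
      have := (J0 (t - r) (2 * l) (by positivity)).trans b2
      by_contra hcon
      push Not at hcon
      nlinarith
    have := norm_sub_le (tp N (Bg l (Bg l g)) (t + r)) (tp N (Bg l (Bg l g)) (t - r))
    linarith
  · rcases le_total l r with hlr | hlr
    · have a1 := Ag_bound N g t l (3 * r) (t + r) hl (by
        rw [add_sub_cancel_left, abs_of_pos hr]; linarith)
      have a2 := Ag_bound N g t l (3 * r) (t - r) hl (by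
        rw [sub_sub_cancel_left, abs_neg, abs_of_pos hr]; linarith)
      have b1 := Hm (3 * r) (by positivity) (by linarith)
      have c1 : (2 * l)⁻¹ * J N g t (3 * r) ≤ 6 * (r * m / l) := by
        calc _ ≤ (2 * l)⁻¹ * (4 * (3 * r) * m) := by gcongr
          _ = _ := by field_simp; ring
      have := norm_sub_le (tp N (Bg l (Bg l g)) (t + r)) (tp N (Bg l (Bg l g)) (t - r))
      linarith
    · have b1 := Hm (3 * l) (by positivity) (by linarith)
      have c1 : (2 * l)⁻¹ * J N g t (3 * l) ≤ 6 * m := by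
        calc _ ≤ (2 * l)⁻¹ * (4 * (3 * l) * m) := by gcongr
          _ = _ := by field_simp; ring
      have e1 := tp_int N (Bg l g) (t + r) l hl
      have e2 := tp_int N (Bg l g) (t - r) l hl
      have htpint : ∀ a b, IntervalIntegrable (tp N (Bg l g)) volume a b := fun a b =>
        (continuous_tp _ _).intervalIntegrable _ _
      have e3 := intervalIntegral.integral_interval_sub_interval_comm
        (htpint (t + r - l) (t + r + l)) (htpint (t - r - l) (t - r + l)) (htpint (t + r - l) (t - r - l))
      have hB : ∀ y, |y - t| ≤ 2 * l → ‖tp N (Bg l g) y‖ ≤ 6 * m := fun y hy =>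
        (Bg_bound N g t l (3 * l) y hl (by linarith)).trans c1
      have f1 : ‖∫ y in (t + r - l)..(t - r - l), tp N (Bg l g) y‖ ≤ 6 * m * |t - r - l - (t + r - l)| := by
        apply intervalIntegral.norm_integral_le_of_norm_le_const
        intro y hy
        rw [uIoc_of_ge (by linarith)] at hy
        exact hB y (abs_le.2 ⟨by linarith [hy.1], by linarith [hy.2]⟩)
      have f2 : ‖∫ y in (t + r + l)..(t - r + l), tp N (Bg l g) y‖ ≤ 6 * m * |t - r + l - (t + r + l)| := by
        apply intervalIntegral.norm_integral_le_of_norm_le_const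
        intro y hy
        rw [uIoc_of_ge (by linarith)] at hy
        exact hB y (abs_le.2 ⟨by linarith [hy.1], by linarith [hy.2]⟩)
      rw [show t - r - l - (t + r - l) = -(2 * r) by ring, abs_neg, abs_of_pos (by positivity)] at f1
      rw [show t - r + l - (t + r + l) = -(2 * r) by ring, abs_neg, abs_of_pos (by positivity)] at f2
      rw [e1, e2, ← mul_sub] at e3
      have f3 := norm_sub_le (∫ y in (t + r - l)..(t - r - l), tp N (Bg l g) y)
        (∫ y in (t + r + l)..(t - r + l), tp N (Bg l g) y)
      rw [← e3] at f3
      have h3 : ‖2 * (l : ℂ) * (tp N (Bg l (Bg l g)) (t + r) - tp N (Bg l (Bg l g)) (t - r))‖ =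
          2 * l * ‖tp N (Bg l (Bg l g)) (t + r) - tp N (Bg l (Bg l g)) (t - r)‖ := by
        rw [norm_mul, norm_mul]
        simp [abs_of_pos hl]
      rw [show 12 * (r * m / l) = (12 * (r * m)) / l by ring, le_div_iff₀ hl]
      have f4 := f3.trans (add_le_add f1 f2)
      have f5 := h3.symm.le.trans f4
      nlinarith


lemma kint (σ h b : ℝ) (hσ0 : 0 < σ) (hσ1 : σ < 1) (hh : 0 ≤ h) (hb : 0 ≤ b) :
    IntervalIntegrable (fun l : ℝ => l ^ (σ - 1) * min h (b / l)) volume 0 1 := by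
  have h1 : IntervalIntegrable (fun l : ℝ => l ^ (σ - 1) * h) volume 0 1 :=
    (intervalIntegral.intervalIntegrable_rpow' (by linarith)).mul_const _
  apply h1.mono_fun
  · apply Measurable.aestronglyMeasurable
    fun_prop
  · rw [Filter.EventuallyLE, ae_restrict_iff' measurableSet_uIoc]
    refine Filter.Eventually.of_forall fun l hl => ?_
    rw [uIoc_of_le zero_le_one] at hl
    have : 0 ≤ b / l := div_nonneg hb hl.1.le
    have h0 : 0 ≤ l ^ (σ - 1) := Real.rpow_nonneg hl.1.le _
    rw [Real.norm_of_nonneg (by positivity), Real.norm_of_nonneg (by positivity)]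
    gcongr
    exact min_le_left _ _

lemma kbound (σ h b : ℝ) (hσ0 : 0 < σ) (hσ1 : σ < 1) (hh : 0 ≤ h) (hb : 0 ≤ b) :
    ∫ l in (0 : ℝ)..1, l ^ (σ - 1) * min h (b / l) ≤
      (1 / σ + 1 / (1 - σ)) * (b ^ σ * h ^ (1 - σ)) := by
  have hs1 : 0 < 1 - σ := by linarith
  have hI := kint σ h b hσ0 hσ1 hh hb
  have hR : 0 ≤ (1 / σ + 1 / (1 - σ)) * (b ^ σ * h ^ (1 - σ)) := by positivity
  have first : ∀ ρ, 0 ≤ ρ → ρ ≤ 1 → ∫ l in (0 : ℝ)..ρ, l ^ (σ - 1) * min h (b / l) ≤ ρ ^ σ * h / σ := by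
    intro ρ h0 h1
    calc _ ≤ ∫ l in (0 : ℝ)..ρ, l ^ (σ - 1) * h := by
          apply intervalIntegral.integral_mono_on h0
          · exact hI.mono_set (by rw [uIcc_of_le h0, uIcc_of_le zero_le_one]; exact Icc_subset_Icc_right h1)
          · exact (intervalIntegral.intervalIntegrable_rpow' (by linarith)).mul_const _
          · intro l hl
            have := Real.rpow_nonneg hl.1 (σ - 1)
            gcongr
            exact min_le_left _ _
      _ = ρ ^ σ * h / σ := by
          rw [intervalIntegral.integral_mul_const, integral_rpow (Or.inl (by linarith))]
          simp only [sub_add_cancel]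
          rw [Real.zero_rpow hσ0.ne']
          ring
  rcases hh.eq_or_lt with rfl | hh'
  · refine le_trans (le_of_eq ?_) hR
    apply intervalIntegral.integral_zero_ae
    refine Filter.Eventually.of_forall fun l hl => ?_
    rw [uIoc_of_le zero_le_one] at hl
    rw [min_eq_left (div_nonneg hb hl.1.le), mul_zero]
  rcases hb.eq_or_lt with rfl | hb'
  · refine le_trans (le_of_eq ?_) hR
    apply intervalIntegral.integral_zero_ae
    refine Filter.Eventually.of_forall fun l hl => ?_
    rw [zero_div, min_eq_right hh, mul_zero]
  have hsplit : h = h ^ σ * h ^ (1 - σ) := by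
    rw [← Real.rpow_add hh']; simp
  rcases le_total h b with hhb | hhb
  · refine (first 1 zero_le_one le_rfl).trans ?_
    have h2 : h ≤ b ^ σ * h ^ (1 - σ) := by
      calc h = h ^ σ * h ^ (1 - σ) := hsplit
        _ ≤ _ := by gcongr
    rw [Real.one_rpow, one_mul]
    calc h / σ = 1 / σ * h := by ring
      _ ≤ 1 / σ * (b ^ σ * h ^ (1 - σ)) := by gcongr
      _ ≤ _ := by gcongr; simp; linarith
  · set ρ := b / h with hρ
    have hρ0 : 0 < ρ := by positivity
    have hρ1 : ρ ≤ 1 := (div_le_one hh').2 hhb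
    have hi1 : IntervalIntegrable (fun l : ℝ => l ^ (σ - 1) * min h (b / l)) volume 0 ρ :=
      hI.mono_set (by rw [uIcc_of_le hρ0.le, uIcc_of_le zero_le_one]; exact Icc_subset_Icc_right hρ1)
    have hi2 : IntervalIntegrable (fun l : ℝ => l ^ (σ - 1) * min h (b / l)) volume ρ 1 :=
      hI.mono_set (by rw [uIcc_of_le hρ1, uIcc_of_le zero_le_one]; exact Icc_subset_Icc_left hρ0.le)
    rw [← intervalIntegral.integral_add_adjacent_intervals hi1 hi2]
    have hnot : (0 : ℝ) ∉ uIcc ρ 1 := by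
      rw [uIcc_of_le hρ1]; intro h; linarith [h.1]
    have second : ∫ l in ρ..1, l ^ (σ - 1) * min h (b / l) ≤ ρ ^ (σ - 1) * b / (1 - σ) := by
      calc _ ≤ ∫ l in ρ..1, l ^ (σ - 2) * b := by
            apply intervalIntegral.integral_mono_on hρ1 hi2
            · exact (intervalIntegral.intervalIntegrable_rpow (Or.inr hnot)).mul_const _
            · intro l hl
              have hl0 : 0 < l := hρ0.trans_le hl.1
              calc l ^ (σ - 1) * min h (b / l) ≤ l ^ (σ - 1) * (b / l) := by
                    gcongr
                    exact min_le_right _ _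
                _ = l ^ (σ - 2) * b := by
                    have h5 : l ^ (σ - 2) = l ^ (σ - 1) / l := by
                      rw [show σ - 2 = (σ - 1) - 1 by ring, Real.rpow_sub_one hl0.ne' (σ - 1)]
                    rw [h5]
                    ring
        _ = (1 - ρ ^ (σ - 1)) / (σ - 1) * b := by
            rw [intervalIntegral.integral_mul_const, integral_rpow (Or.inr ⟨by linarith, hnot⟩)]
            rw [show σ - 2 + 1 = σ - 1 by ring, Real.one_rpow]
        _ = (ρ ^ (σ - 1) - 1) * b / (1 - σ) := by
            rw [show σ - 1 = -(1 - σ) by ring, div_neg]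
            ring
        _ ≤ _ := by gcongr; linarith
    have f1 : ρ ^ σ * h = b ^ σ * h ^ (1 - σ) := by
      rw [hρ, Real.div_rpow hb hh]
      nth_rw 2 [hsplit]
      field_simp
    have f2 : ρ ^ (σ - 1) * b = b ^ σ * h ^ (1 - σ) := by
      rw [← f1, Real.rpow_sub_one hρ0.ne', hρ]
      field_simp
    have f3 := first ρ hρ0.le hρ1
    rw [f1] at f3
    rw [f2] at second
    calc _ ≤ _ := add_le_add f3 second
      _ = _ := by ring

/-- The multiplier. -/
def mult (σ : ℝ) (n : ℕ) : ℝ := ∫ l in (0 : ℝ)..1, l ^ (σ - 1) * Real.sinc (fr n * l) ^ 2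

lemma mult_int (σ : ℝ) (hσ0 : 0 < σ) (w : ℝ) (a b : ℝ) :
    IntervalIntegrable (fun l : ℝ => l ^ (σ - 1) * Real.sinc (w * l) ^ 2) volume a b := by
  apply (intervalIntegral.intervalIntegrable_rpow' (by linarith)).mul_continuousOn
  apply Continuous.continuousOn
  have := Real.continuous_sinc
  fun_prop

lemma mult_lower (σ : ℝ) (hσ0 : 0 < σ) (hσ1 : σ < 1) (n : ℕ) :
    (4 / Real.pi ^ 2 / σ) * (fr n) ^ (-σ) ≤ mult σ n := by
  have hf := fr_pos n
  have hf1 : 1 ≤ fr n := by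
    unfold fr
    have : (1 : ℝ) ≤ n + 1 := by linarith [n.cast_nonneg (α := ℝ)]
    nlinarith [Real.pi_gt_three]
  have hρ0 : 0 < (fr n)⁻¹ := by positivity
  have hρ1 : (fr n)⁻¹ ≤ 1 := inv_le_one_of_one_le₀ hf1
  calc (4 / Real.pi ^ 2 / σ) * (fr n) ^ (-σ)
      = ∫ l in (0 : ℝ)..(fr n)⁻¹, l ^ (σ - 1) * (2 / Real.pi) ^ 2 := by
        rw [intervalIntegral.integral_mul_const, integral_rpow (Or.inl (by linarith))]
        simp only [sub_add_cancel]
        rw [Real.zero_rpow hσ0.ne', Real.inv_rpow hf.le, Real.rpow_neg hf.le]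
        ring
    _ ≤ ∫ l in (0 : ℝ)..(fr n)⁻¹, l ^ (σ - 1) * Real.sinc (fr n * l) ^ 2 := by
        apply intervalIntegral.integral_mono_on hρ0.le
        · exact (intervalIntegral.intervalIntegrable_rpow' (by linarith)).mul_const _
        · exact mult_int σ hσ0 _ _ _
        · intro l hl
          have hp := Real.rpow_nonneg hl.1 (σ - 1)
          gcongr
          have hx0 : 0 ≤ fr n * l := mul_nonneg hf.le hl.1
          have hx1 : fr n * l ≤ 1 := by
            calc _ ≤ fr n * (fr n)⁻¹ := by gcongr; exact hl.2
              _ = 1 := mul_inv_cancel₀ hf.ne'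
          rcases hx0.eq_or_lt with h0 | h0
          · rw [← h0, Real.sinc_zero, div_le_one Real.pi_pos]
            linarith [Real.pi_gt_three]
          · rw [Real.sinc_of_ne_zero h0.ne', le_div_iff₀ h0]
            exact Real.mul_le_sin hx0 (by linarith [Real.pi_gt_three])
    _ ≤ mult σ n := by
        unfold mult
        apply intervalIntegral.integral_mono_interval le_rfl hρ0.le hρ1
        · rw [Filter.EventuallyLE, ae_restrict_iff' measurableSet_Ioc]
          refine Filter.Eventually.of_forall fun l hl => ?_
          have hp := Real.rpow_nonneg hl.1.le (σ - 1)
          simp only [Pi.zero_apply]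
          positivity
        · exact mult_int σ hσ0 _ _ _

lemma tp_rep (σ : ℝ) (hσ0 : 0 < σ) (N : ℕ) (g : ℕ → ℂ) (s : ℝ) :
    IntervalIntegrable (fun l : ℝ => ((l ^ (σ - 1) : ℝ) : ℂ) * tp N (Bg l (Bg l g)) s) volume 0 1 ∧
    tp N (fun n => g n * mult σ n) s =
      ∫ l in (0 : ℝ)..1, ((l ^ (σ - 1) : ℝ) : ℂ) * tp N (Bg l (Bg l g)) s := by
  have hii : ∀ n, IntervalIntegrable (fun l : ℝ => ((l ^ (σ - 1) * Real.sinc (fr n * l) ^ 2 : ℝ) : ℂ))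
      volume 0 1 := fun n => 
    ⟨(mult_int σ hσ0 (fr n) 0 1).1.ofReal, (mult_int σ hσ0 (fr n) 0 1).2.ofReal⟩
  have key : ∀ l : ℝ, ((l ^ (σ - 1) : ℝ) : ℂ) * tp N (Bg l (Bg l g)) s =
      ∑ n ∈ Finset.range N, ((l ^ (σ - 1) * Real.sinc (fr n * l) ^ 2 : ℝ) : ℂ) *
        (g n * Complex.exp (-(Real.pi * (n + 1) * s) * Complex.I)) := by
    intro l
    unfold tp
    rw [Finset.mul_sum]
    refine Finset.sum_congr rfl fun n _ => ?_
    push_cast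
    ring
  simp only [key]
  constructor
  · have := IntervalIntegrable.sum (μ := volume) (a := 0) (b := 1) (Finset.range N)
      (f := fun n (l : ℝ) => ((l ^ (σ - 1) * Real.sinc (fr n * l) ^ 2 : ℝ) : ℂ) *
        (g n * Complex.exp (-(Real.pi * (n + 1) * s) * Complex.I)))
      (fun n _ => (hii n).mul_const _)
    rw [Finset.sum_fn] at this
    exact this
  · rw [intervalIntegral.integral_finsetSum (fun n _ => (hii n).mul_const _)]
    unfold tp
    refine Finset.sum_congr rfl fun n _ => ?_
    rw [intervalIntegral.integral_mul_const, intervalIntegral.integral_ofReal]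
    unfold mult
    ring

lemma pointwise_bound (σ : ℝ) (hσ0 : 0 < σ) (hσ1 : σ < 1) (N : ℕ) (g : ℕ → ℂ)
    (t r m hp hm : ℝ) (hr : 0 < r) (hr1 : r ≤ 1)
    (hm0 : 0 ≤ m) (hp0 : 0 ≤ hp) (hn0 : 0 ≤ hm)
    (Hm : ∀ ρ, 0 < ρ → ρ ≤ 3 → J N g t ρ ≤ 4 * ρ * m)
    (Hp : ∀ ρ, 0 < ρ → ρ ≤ 3 → J N g (t + r) ρ ≤ 4 * ρ * hp)
    (Hn : ∀ ρ, 0 < ρ → ρ ≤ 3 → J N g (t - r) ρ ≤ 4 * ρ * hm) :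
    ‖tp N (fun n => g n * mult σ n) (t + r) - tp N (fun n => g n * mult σ n) (t - r)‖ ≤
      12 * (1 / σ + 1 / (1 - σ)) * (r ^ σ * (m ^ σ * (hp + hm) ^ (1 - σ))) := by
  obtain ⟨i1, e1⟩ := tp_rep σ hσ0 N g (t + r)
  obtain ⟨i2, e2⟩ := tp_rep σ hσ0 N g (t - r)
  have hk := kint σ (hp + hm) (r * m) hσ0 hσ1 (by positivity) (by positivity)
  have hb := kbound σ (hp + hm) (r * m) hσ0 hσ1 (by positivity) (by positivity)
  rw [e1, e2, ← intervalIntegral.integral_sub i1 i2]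
  calc _ ≤ ∫ l in (0 : ℝ)..1, 12 * (l ^ (σ - 1) * min (hp + hm) (r * m / l)) := by
        apply intervalIntegral.norm_integral_le_of_norm_le zero_le_one
        · refine Filter.Eventually.of_forall fun l hl => ?_
          rw [← mul_sub, norm_mul, Complex.norm_real,
            Real.norm_of_nonneg (Real.rpow_nonneg hl.1.le _)]
          have := D_bound N g t r l m hp hm hr hr1 hl.1 hl.2 Hm Hp Hn
          have h0 := Real.rpow_nonneg hl.1.le (σ - 1)
          nlinarith
        · exact hk.const_mul _
    _ = 12 * ∫ l in (0 : ℝ)..1, (l ^ (σ - 1) * min (hp + hm) (r * m / l)) :=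
        intervalIntegral.integral_const_mul _ _
    _ ≤ 12 * ((1 / σ + 1 / (1 - σ)) * ((r * m) ^ σ * (hp + hm) ^ (1 - σ))) := by gcongr
    _ = _ := by rw [Real.mul_rpow hr.le hm0]; ring


lemma exp_orth (k : ℤ) (hk : k ≠ 0) :
    ∫ y in (-8 : ℝ)..8, Complex.exp ((Real.pi * k * Complex.I) * y) = 0 := by
  have hc : (Real.pi * k * Complex.I : ℂ) ≠ 0 := by
    refine mul_ne_zero (mul_ne_zero ?_ ?_) Complex.I_ne_zero
    · exact_mod_cast Real.pi_pos.ne'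
    · exact_mod_cast hk
  rw [integral_exp_mul_complex hc]
  have : Complex.exp ((Real.pi * k * Complex.I) * (8 : ℝ)) =
      Complex.exp ((Real.pi * k * Complex.I) * (-8 : ℝ)) := by
    rw [Complex.exp_eq_exp_iff_exists_int]
    refine ⟨8 * k, ?_⟩
    push_cast
    ring
  rw [this]
  simp

lemma tp_l2 (N : ℕ) (g : ℕ → ℂ) :
    ∫ y in (-8 : ℝ)..8, ‖tp N g y‖ ^ 2 = 16 * ∑ n ∈ Finset.range N, ‖g n‖ ^ 2 := by
  have hcont : Continuous (tp N g) := continuous_tp N g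
  have key : ∀ y : ℝ, ((‖tp N g y‖ ^ 2 : ℝ) : ℂ) =
      ∑ m ∈ Finset.range N, ∑ n ∈ Finset.range N, (g m * (starRingEnd ℂ) (g n)) *
        Complex.exp ((Real.pi * ((n - m : ℤ) : ℂ) * Complex.I) * y) := by
    intro y
    rw [Complex.ofReal_pow, ← Complex.mul_conj']
    unfold tp
    rw [map_sum, Finset.sum_mul_sum]
    refine Finset.sum_congr rfl fun m _ => Finset.sum_congr rfl fun n _ => ?_
    rw [map_mul, ← Complex.exp_conj, mul_mul_mul_comm, ← Complex.exp_add]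
    congr 2
    simp only [map_mul, map_neg, map_add, Complex.conj_ofReal, Complex.conj_I, map_one, map_natCast]
    push_cast
    ring
  have h2 : ((∫ y in (-8 : ℝ)..8, ‖tp N g y‖ ^ 2 : ℝ) : ℂ) =
      ((16 * ∑ n ∈ Finset.range N, ‖g n‖ ^ 2 : ℝ) : ℂ) := by
    rw [← intervalIntegral.integral_ofReal]
    simp only [key]
    rw [intervalIntegral.integral_finsetSum
      (fun m _ => Continuous.intervalIntegrable (by fun_prop) _ _)]
    push_cast
    rw [Finset.mul_sum]
    refine Finset.sum_congr rfl fun m hm => ?_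
    rw [intervalIntegral.integral_finsetSum
      (fun m _ => Continuous.intervalIntegrable (by fun_prop) _ _)]
    rw [Finset.sum_eq_single m]
    · rw [intervalIntegral.integral_const_mul, Complex.mul_conj']
      simp
      ring
    · intro n _ hn
      have h3 := exp_orth (n - m : ℤ) (by omega)
      rw [intervalIntegral.integral_const_mul, ← mul_zero (g m * (starRingEnd ℂ) (g n))]
      congr 1
      push_cast at h3
      exact h3
    · intro h; exact absurd hm h
  exact_mod_cast h2

/-- truncated modulus -/
def phi (N : ℕ) (g : ℕ → ℂ) : ℝ → ℝ≥0∞ := (Icc (-8 : ℝ) 8).indicator (fun y => ‖tp N g y‖ₑ)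

lemma measurable_phi (N : ℕ) (g : ℕ → ℂ) : Measurable (phi N g) :=
  ((continuous_tp N g).enorm.measurable).indicator measurableSet_Icc

lemma phi_bdd (N : ℕ) (g : ℕ → ℂ) : ∃ K : ℝ≥0, ∀ x, phi N g x ≤ K := by
  refine ⟨∑ n ∈ Finset.range N, ‖g n‖₊, fun x => ?_⟩
  refine (indicator_le_self _ _ _).trans ?_
  rw [enorm_eq_nnnorm, ENNReal.coe_le_coe]
  unfold tp
  refine (nnnorm_sum_le _ _).trans ?_
  refine Finset.sum_le_sum fun n _ => ?_
  rw [← NNReal.coe_le_coe]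
  simp only [coe_nnnorm, norm_mul]
  have : -(↑Real.pi * ((n : ℂ) + 1) * (x : ℂ)) * Complex.I = ((-(Real.pi * (n + 1) * x) : ℝ) : ℂ) * Complex.I := by
    push_cast; ring
  rw [this, Complex.norm_exp_ofReal_mul_I, mul_one]

lemma phi_l2 (N : ℕ) (g : ℕ → ℂ) :
    ∫⁻ y, phi N g y ^ 2 = ENNReal.ofReal (16 * ∑ n ∈ Finset.range N, ‖g n‖ ^ 2) := by
  have hcont : Continuous (tp N g) := continuous_tp N g
  have h1 : ∀ y, phi N g y ^ 2 = (Icc (-8 : ℝ) 8).indicator (fun y => ENNReal.ofReal (‖tp N g y‖ ^ 2)) y := by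
    intro y
    unfold phi
    by_cases hy : y ∈ Icc (-8 : ℝ) 8
    · rw [indicator_of_mem hy, indicator_of_mem hy, ENNReal.ofReal_pow (norm_nonneg _),
        ofReal_norm]
    · rw [indicator_of_notMem hy, indicator_of_notMem hy]; simp
  simp only [h1]
  rw [lintegral_indicator measurableSet_Icc, ← tp_l2, intervalIntegral.integral_of_le (by norm_num),
    ← integral_Icc_eq_integral_Ioc, ofReal_integral_eq_lintegral_ofReal]
  · exact Continuous.integrableOn_Icc (by fun_prop)
  · exact Filter.Eventually.of_forall fun y => by positivity

/-- the maximal function -/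
def HM (N : ℕ) (g : ℕ → ℂ) : ℝ → ℝ≥0∞ := avgMax (phi N g)

lemma HM_ne_top (N : ℕ) (g : ℕ → ℂ) (t : ℝ) : HM N g t ≠ ⊤ := by
  obtain ⟨K, hK⟩ := phi_bdd N g
  exact ne_top_of_le_ne_top ENNReal.coe_ne_top (avgMax_bdd _ _ hK t)

lemma measurable_HM (N : ℕ) (g : ℕ → ℂ) : Measurable (HM N g) :=
  measurable_avgMax _ (measurable_phi N g)

lemma HM_l2 (N : ℕ) (g : ℕ → ℂ) :
    ∫⁻ t, HM N g t ^ 2 ≤ ENNReal.ofReal (512 * ∑ n ∈ Finset.range N, ‖g n‖ ^ 2) := by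
  obtain ⟨K, hK⟩ := phi_bdd N g
  refine (avgMax_strong _ (measurable_phi N g) K hK).trans ?_
  rw [phi_l2, show (32 : ℝ≥0∞) = ENNReal.ofReal 32 by simp, ← ENNReal.ofReal_mul (by norm_num)]
  apply ENNReal.ofReal_le_ofReal
  linarith

lemma J_le (N : ℕ) (g : ℕ → ℂ) (t ρ : ℝ) (ht : |t| ≤ 2) (hρ : 0 < ρ) (hρ3 : ρ ≤ 3) :
    J N g t ρ ≤ 4 * ρ * (HM N g t).toReal := by
  obtain ⟨q, hq1, hq2⟩ := exists_rat_btwn (show ρ < 2 * ρ by linarith)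
  have hq0 : (0 : ℝ) < q := hρ.trans hq1
  have hq6 : (q : ℝ) ≤ 6 := by linarith
  have hcont : Continuous (tp N g) := continuous_tp N g
  have ht' := abs_le.1 ht
  have h1 : J N g t ρ ≤ J N g t q := J_mono _ _ _ _ _ _ hρ.le (by linarith) (by linarith)
  have h2 : ENNReal.ofReal (J N g t q) = ∫⁻ y in Metric.ball t (q : ℝ), phi N g y := by
    unfold J
    rw [intervalIntegral.integral_of_le (by linarith), integral_Ioc_eq_integral_Ioo,
      ofReal_integral_eq_lintegral_ofReal, Real.ball_eq_Ioo]
    · refine setLIntegral_congr_fun measurableSet_Ioo fun y hy => ?_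
      have : y ∈ Icc (-8 : ℝ) 8 := ⟨by linarith [hy.1], by linarith [hy.2]⟩
      simp only [phi]
      rw [indicator_of_mem this, ofReal_norm]
    · exact (Continuous.integrableOn_Icc (by fun_prop)).mono_set Ioo_subset_Icc_self
    · exact Filter.Eventually.of_forall fun y => norm_nonneg _
  have h3 : (ENNReal.ofReal (2 * (q : ℝ)))⁻¹ * ∫⁻ y in Metric.ball t (q : ℝ), phi N g y ≤ HM N g t := by
    unfold HM avgMax
    exact le_iSup₂_of_le q ⟨by exact_mod_cast hq0, by exact_mod_cast hq6⟩ le_rfl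
  rw [← h2, mul_comm, ← div_eq_mul_inv, ← ENNReal.ofReal_div_of_pos (by positivity)] at h3
  have h4 := (ENNReal.ofReal_le_iff_le_toReal (HM_ne_top N g t)).1 h3
  rw [div_le_iff₀ (by positivity)] at h4
  have h5 : 0 ≤ (HM N g t).toReal := ENNReal.toReal_nonneg
  nlinarith


lemma polar : ∃ K : ℝ≥0, ∀ f : ℝ → ℝ≥0∞, Measurable f →
    ∫⁻ x, f ‖x‖ ∂μΘ ≤ K * ∫⁻ r in Ioo (0 : ℝ) 1, ENNReal.ofReal (r ^ 2) * f r := by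
  have hfin : (volume : Measure E3).toSphere univ ≠ ⊤ := measure_ne_top _ _
  refine ⟨((volume : Measure E3).toSphere univ).toNNReal, fun f hf => ?_⟩
  rw [ENNReal.coe_toNNReal hfin]
  have hdim : Module.finrank ℝ E3 - 1 = 2 := by simp
  set F : ℝ → ℝ≥0∞ := (Iio (1 : ℝ)).indicator f with hF
  have hFm : Measurable F := hf.indicator measurableSet_Iio
  apply le_of_eq
  calc ∫⁻ x, f ‖x‖ ∂μΘ = ∫⁻ x : E3, F ‖x‖ := by
        unfold μΘ
        rw [← lintegral_indicator measurableSet_ball]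
        congr 1; funext x
        simp [hF, indicator]
    _ = ∫⁻ x : ({(0)}ᶜ : Set E3), F ‖x.1‖ ∂((volume : Measure E3).comap (↑)) := by
        rw [lintegral_subtype_comap (measurableSet_singleton _).compl fun x => F ‖x‖,
          restrict_compl_singleton]
    _ = ∫⁻ x, F x.2 ∂(volume : Measure E3).toSphere.prod (.volumeIoiPow (Module.finrank ℝ E3 - 1)) := by
        rw [← (volume : Measure E3).measurePreserving_homeomorphUnitSphereProd.lintegral_comp_emb
          (Homeomorph.measurableEmbedding _)]
        simp
    _ = (volume : Measure E3).toSphere univ *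
          ∫⁻ y, F y ∂(Measure.volumeIoiPow (Module.finrank ℝ E3 - 1)) := by
        rw [lintegral_prod _ (by fun_prop)]
        simp [mul_comm]
    _ = (volume : Measure E3).toSphere univ *
          ∫⁻ r in Ioi (0 : ℝ), ENNReal.ofReal (r ^ 2) * F r := by
        rw [hdim, Measure.volumeIoiPow, lintegral_withDensity_eq_lintegral_mul _ (by fun_prop)
          (by fun_prop)]
        congr 1
        exact lintegral_subtype_comap measurableSet_Ioi (fun r : ℝ => ENNReal.ofReal (r ^ 2) * F r)
    _ = _ := by
        congr 1
        rw [← lintegral_indicator measurableSet_Ioi, ← lintegral_indicator measurableSet_Ioo]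
        congr 1; funext r
        by_cases h0 : 0 < r <;> by_cases h1 : r < 1 <;> simp [hF, indicator, h0, h1]


/-- partial sums of the evolution -/
def vN (N : ℕ) (c : ℕ → ℂ) (t : ℝ) (x : E3) : ℂ :=
  ∑ n ∈ Finset.range N, Sc t c n * (eFun (n + 1) x : ℂ)

lemma vN_eq (N : ℕ) (c : ℕ → ℂ) (t : ℝ) (x : E3) :
    vN N c t x = (tp N c (t - ‖x‖) - tp N c (t + ‖x‖)) /
      (2 * Complex.I * (Real.sqrt (2 * Real.pi) * ‖x‖ : ℝ)) := by
  unfold vN tp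
  rw [← Finset.sum_sub_distrib, Finset.sum_div]
  refine Finset.sum_congr rfl fun n _ => ?_
  unfold Sc eFun
  generalize (‖x‖ : ℝ) = r
  have e1 : Complex.exp (-(Real.pi * (n + 1) * ((t - r : ℝ) : ℂ)) * Complex.I) =
      Complex.exp (-(Real.pi * (n + 1) * t) * Complex.I) *
        Complex.exp ((Real.pi * (n + 1) * r) * Complex.I) := by
    rw [← Complex.exp_add]; congr 1; push_cast; ring
  have e2 : Complex.exp (-(Real.pi * (n + 1) * ((t + r : ℝ) : ℂ)) * Complex.I) =
      Complex.exp (-(Real.pi * (n + 1) * t) * Complex.I) *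
        Complex.exp (-(Real.pi * (n + 1) * r) * Complex.I) := by
    rw [← Complex.exp_add]; congr 1; push_cast; ring
  rw [e1, e2, Complex.ofReal_div, Complex.ofReal_sin, Complex.sin]
  have e3 : ((((n + 1 : ℕ) : ℝ) * Real.pi * r : ℝ) : ℂ) = Real.pi * (n + 1) * r := by
    push_cast; ring
  rw [e3]
  have hI : (2 * Complex.I)⁻¹ = - Complex.I / 2 := by
    rw [mul_inv, Complex.inv_I]; ring
  rw [div_eq_mul_inv _ (2 * Complex.I * _), mul_inv (2 * Complex.I), hI]
  ring

lemma vN_bound (N : ℕ) (c : ℕ → ℂ) (t : ℝ) (x : E3) :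
    ‖vN N c t x‖ ≤ ‖tp N c (t + ‖x‖) - tp N c (t - ‖x‖)‖ / ‖x‖ := by
  rw [vN_eq, norm_div, norm_sub_rev]
  rcases (norm_nonneg x).eq_or_lt with h | h
  · rw [← h]; simp
  · have h1 : ‖x‖ ≤ ‖(2 * Complex.I * (Real.sqrt (2 * Real.pi) * ‖x‖ : ℝ) : ℂ)‖ := by
      rw [norm_mul, Complex.norm_real, norm_mul, Complex.norm_I, mul_one, Real.norm_of_nonneg (by positivity)]
      have : 1 ≤ Real.sqrt (2 * Real.pi) := by
        rw [Real.one_le_sqrt]; linarith [Real.pi_gt_three]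
      have h2 : ‖(2 : ℂ)‖ = 2 := by simp
      rw [h2]
      nlinarith
    gcongr

lemma vN_slice (σ : ℝ) (hσ0 : 0 < σ) (hσ1 : σ < 1) : ∃ K : ℝ≥0, ∀ (N : ℕ) (g : ℕ → ℂ) (t : ℝ),
    t ∈ Ioo (-1 : ℝ) 1 →
    ∫⁻ x, ‖vN N (fun n => g n * mult σ n) t x‖ₑ ^ (2 / (1 - σ)) ∂μΘ ≤
      K * (∫⁻ s, HM N g s ^ 2) * HM N g t ^ (2 * σ / (1 - σ)) := by
  obtain ⟨K, hK⟩ := polar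
  have hs : 0 < 1 - σ := by linarith
  set q := 2 / (1 - σ) with hq
  have hq0 : 0 < q := by positivity
  obtain ⟨A, hA⟩ : ∃ A : ℝ, A = 12 * (1 / σ + 1 / (1 - σ)) := ⟨_, rfl⟩
  have hA0 : 0 < A := by rw [hA]; positivity
  refine ⟨K * (Real.toNNReal (A ^ q) * 4), fun N g t ht => ?_⟩
  set c : ℕ → ℂ := fun n => g n * mult σ n with hc
  set f : ℝ → ℝ≥0∞ := fun r => ENNReal.ofReal ((‖tp N c (t + r) - tp N c (t - r)‖ / r) ^ q) with hf
  have hcont : Continuous (tp N c) := continuous_tp N c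
  have hfm : Measurable f := by
    apply ENNReal.measurable_ofReal.comp
    apply Measurable.pow_const
    apply Measurable.div _ measurable_id
    apply Continuous.measurable
    fun_prop
  have h1 : ∀ x, ‖vN N c t x‖ₑ ^ q ≤ f ‖x‖ := by
    intro x
    rw [← ofReal_norm, ENNReal.ofReal_rpow_of_nonneg (norm_nonneg _) hq0.le]
    apply ENNReal.ofReal_le_ofReal
    gcongr
    exact vN_bound N c t x
  have h2 : ∀ r ∈ Ioo (0 : ℝ) 1, ENNReal.ofReal (r ^ 2) * f r ≤
      (ENNReal.ofReal (A ^ q) * HM N g t ^ (2 * σ / (1 - σ)) * 2) *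
        (HM N g (t + r) ^ 2 + HM N g (t - r) ^ 2) := by
    intro r hr
    have hr0 := hr.1
    set m := (HM N g t).toReal with hm
    set hp := (HM N g (t + r)).toReal with hhp
    set hn := (HM N g (t - r)).toReal with hhn
    have m0 : 0 ≤ m := ENNReal.toReal_nonneg
    have p0 : 0 ≤ hp := ENNReal.toReal_nonneg
    have n0 : 0 ≤ hn := ENNReal.toReal_nonneg
    have hb := pointwise_bound σ hσ0 hσ1 N g t r m hp hn hr0 hr.2.le m0 p0 n0
      (fun ρ h1 h2 => J_le N g t ρ (abs_le.2 ⟨by linarith [ht.1], by linarith [ht.2]⟩) h1 h2)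
      (fun ρ h1 h2 => J_le N g (t + r) ρ
        (abs_le.2 ⟨by linarith [ht.1, hr.1], by linarith [ht.2, hr.2]⟩) h1 h2)
      (fun ρ h1 h2 => J_le N g (t - r) ρ
        (abs_le.2 ⟨by linarith [ht.1, hr.2], by linarith [ht.2, hr.1]⟩) h1 h2)
    rw [← hA] at hb
    have hreal : r ^ 2 * (‖tp N c (t + r) - tp N c (t - r)‖ / r) ^ q ≤
        A ^ q * m ^ (2 * σ / (1 - σ)) * 2 * (hp ^ 2 + hn ^ 2) := by
      calc r ^ 2 * (‖tp N c (t + r) - tp N c (t - r)‖ / r) ^ q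
          ≤ r ^ 2 * (A * (r ^ σ * (m ^ σ * (hp + hn) ^ (1 - σ))) / r) ^ q := by gcongr
        _ = r ^ 2 * (A * (r ^ (σ - 1) * (m ^ σ * (hp + hn) ^ (1 - σ)))) ^ q := by
            congr 2
            rw [Real.rpow_sub_one hr0.ne']
            ring
        _ = A ^ q * m ^ (2 * σ / (1 - σ)) * (hp + hn) ^ 2 := by
            rw [Real.mul_rpow hA0.le (by positivity), Real.mul_rpow (by positivity) (by positivity),
              Real.mul_rpow (by positivity) (by positivity), ← Real.rpow_mul hr0.le,
              ← Real.rpow_mul m0, ← Real.rpow_mul (by positivity),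
              show (σ - 1) * q = -2 by rw [hq]; field_simp; ring,
              show σ * q = 2 * σ / (1 - σ) by rw [hq]; ring,
              show (1 - σ) * q = 2 by rw [hq]; field_simp, Real.rpow_neg hr0.le, Real.rpow_two,
              Real.rpow_two]
            field_simp
        _ ≤ A ^ q * m ^ (2 * σ / (1 - σ)) * (2 * (hp ^ 2 + hn ^ 2)) := by
            gcongr
            nlinarith [sq_nonneg (hp - hn)]
        _ = _ := by ring
    rw [hf]
    simp only
    rw [← ENNReal.ofReal_mul (by positivity)]
    refine (ENNReal.ofReal_le_ofReal hreal).trans (le_of_eq ?_)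
    rw [ENNReal.ofReal_mul (by positivity), ENNReal.ofReal_mul (by positivity),
      ENNReal.ofReal_mul (by positivity), ENNReal.ofReal_add (by positivity) (by positivity),
      ENNReal.ofReal_pow p0, ENNReal.ofReal_pow n0,
      ← ENNReal.ofReal_rpow_of_nonneg m0 (by positivity),
      ENNReal.ofReal_toReal (HM_ne_top _ _ _), ENNReal.ofReal_toReal (HM_ne_top _ _ _),
      ENNReal.ofReal_toReal (HM_ne_top _ _ _)]
    simp
  have hHM : Measurable (HM N g) := measurable_HM N g
  calc ∫⁻ x, ‖vN N c t x‖ₑ ^ q ∂μΘ ≤ ∫⁻ x, f ‖x‖ ∂μΘ := lintegral_mono h1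
    _ ≤ K * ∫⁻ r in Ioo (0 : ℝ) 1, ENNReal.ofReal (r ^ 2) * f r := hK f hfm
    _ ≤ K * ∫⁻ r in Ioo (0 : ℝ) 1, (ENNReal.ofReal (A ^ q) * HM N g t ^ (2 * σ / (1 - σ)) * 2) *
        (HM N g (t + r) ^ 2 + HM N g (t - r) ^ 2) := by
        exact mul_le_mul_right (setLIntegral_mono' measurableSet_Ioo h2) _
    _ ≤ K * ∫⁻ r, (ENNReal.ofReal (A ^ q) * HM N g t ^ (2 * σ / (1 - σ)) * 2) *
        (HM N g (t + r) ^ 2 + HM N g (t - r) ^ 2) :=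
        mul_le_mul_right (setLIntegral_le_lintegral _ _) _
    _ = K * ((ENNReal.ofReal (A ^ q) * HM N g t ^ (2 * σ / (1 - σ)) * 2) *
        ((∫⁻ s, HM N g s ^ 2) + ∫⁻ s, HM N g s ^ 2)) := by
        rw [lintegral_const_mul _ (by fun_prop), lintegral_add_left (by fun_prop),
          lintegral_add_left_eq_self (μ := volume) (fun r => HM N g r ^ 2) t,
          lintegral_sub_left_eq_self (μ := volume) (fun r => HM N g r ^ 2) t]
    _ = _ := by
        push_cast
        rw [ENNReal.ofReal]
        ring

lemma finite_est (σ : ℝ) (hσ0 : 0 < σ) (hσ1 : σ < 1) : ∃ C : ℝ≥0, ∀ (N : ℕ) (c : ℕ → ℂ) (T : ℝ),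
    T ≤ 1 →
    ∫⁻ t in Ioo (-T) T, (∫⁻ x, ‖vN N c t x‖ₑ ^ (2 / (1 - σ)) ∂μΘ) ^ ((1 - σ) / σ) ≤
      C * HNorm σ c ^ (2 / σ) := by
  obtain ⟨K, hK⟩ := vN_slice σ hσ0 hσ1
  have hs : 0 < 1 - σ := by linarith
  set κ := 4 / Real.pi ^ 2 / σ with hκ
  have hκ0 : 0 < κ := by have := Real.pi_pos; positivity
  refine ⟨K ^ ((1 - σ) / σ) * (Real.toNNReal (512 * (κ⁻¹) ^ 2)) ^ (1 / σ), fun N c T hT => ?_⟩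
  set g : ℕ → ℂ := fun n => c n / mult σ n with hg
  have hmpos : ∀ n, 0 < mult σ n := fun n => lt_of_lt_of_le
    (mul_pos hκ0 (Real.rpow_pos_of_pos (fr_pos n) _)) (mult_lower σ hσ0 hσ1 n)
  have hcg : c = fun n => g n * mult σ n := by
    funext n
    have : (mult σ n : ℂ) ≠ 0 := by exact_mod_cast (hmpos n).ne'
    simp only [hg]
    field_simp
  set Q := ∫⁻ s, HM N g s ^ 2 with hQ
  have hgn : ∀ n, ‖g n‖ ^ 2 ≤ (κ⁻¹) ^ 2 * ((fr n) ^ (2 * σ) * ‖c n‖ ^ 2) := by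
    intro n
    have h1 : ‖g n‖ ≤ κ⁻¹ * ((fr n) ^ σ * ‖c n‖) := by
      simp only [hg]
      rw [norm_div, Complex.norm_real, Real.norm_of_nonneg (hmpos n).le, div_le_iff₀ (hmpos n)]
      have h2 := mult_lower σ hσ0 hσ1 n
      have h3 : (fr n) ^ σ * (fr n) ^ (-σ) = 1 := by
        rw [← Real.rpow_add (fr_pos n)]; simp
      have h4 : 0 < (fr n) ^ σ := Real.rpow_pos_of_pos (fr_pos n) _
      calc ‖c n‖ = κ⁻¹ * ((fr n) ^ σ * ‖c n‖) * (κ * (fr n) ^ (-σ)) := by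
            calc ‖c n‖ = (κ⁻¹ * κ) * ((fr n) ^ σ * (fr n) ^ (-σ)) * ‖c n‖ := by
                  rw [h3, inv_mul_cancel₀ hκ0.ne']; ring
              _ = _ := by ring
        _ ≤ _ := by gcongr
    calc ‖g n‖ ^ 2 ≤ (κ⁻¹ * ((fr n) ^ σ * ‖c n‖)) ^ 2 := by gcongr
      _ = (κ⁻¹) ^ 2 * (((fr n) ^ σ) ^ 2 * ‖c n‖ ^ 2) := by ring
      _ = _ := by
        rw [mul_comm 2 σ, Real.rpow_mul (fr_pos n).le, Real.rpow_two]
  have hQb : Q ≤ (Real.toNNReal (512 * (κ⁻¹) ^ 2) : ℝ≥0∞) * HNorm σ c ^ (2 : ℝ) := by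
    refine (HM_l2 N g).trans ?_
    have h1 : 512 * ∑ n ∈ Finset.range N, ‖g n‖ ^ 2 ≤
        (512 * (κ⁻¹) ^ 2) * ∑ n ∈ Finset.range N, ((fr n) ^ (2 * σ) * ‖c n‖ ^ 2) := by
      rw [mul_assoc, Finset.mul_sum (Finset.range N) _ ((κ⁻¹) ^ 2)]
      gcongr with n _
      exact hgn n
    refine (ENNReal.ofReal_le_ofReal h1).trans ?_
    rw [ENNReal.ofReal_mul (by positivity)]
    have h2 : ENNReal.ofReal (∑ n ∈ Finset.range N, ((fr n) ^ (2 * σ) * ‖c n‖ ^ 2)) ≤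
        HNorm σ c ^ (2 : ℝ) := by
      unfold HNorm
      rw [← ENNReal.rpow_mul]
      norm_num
      rw [ENNReal.ofReal_sum_of_nonneg
        (fun n _ => mul_nonneg (Real.rpow_nonneg (fr_pos n).le _) (by positivity))]
      refine le_trans (le_of_eq ?_) (ENNReal.sum_le_tsum (Finset.range N))
      refine Finset.sum_congr rfl fun n _ => ?_
      rw [ENNReal.ofReal_mul (Real.rpow_nonneg (fr_pos n).le _), ENNReal.ofReal_pow (norm_nonneg _),
        ofReal_norm, enorm_eq_nnnorm]
      rfl
    exact mul_le_mul_right h2 _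
  have hHM : Measurable (HM N g) := measurable_HM N g
  have he : 0 ≤ (1 - σ) / σ := by positivity
  calc ∫⁻ t in Ioo (-T) T, (∫⁻ x, ‖vN N c t x‖ₑ ^ (2 / (1 - σ)) ∂μΘ) ^ ((1 - σ) / σ)
      ≤ ∫⁻ t in Ioo (-T) T, (K ^ ((1 - σ) / σ) * Q ^ ((1 - σ) / σ)) * HM N g t ^ 2 := by
        refine setLIntegral_mono' measurableSet_Ioo fun t ht => ?_
        have h1 := hK N g t ⟨by linarith [ht.1], by linarith [ht.2]⟩
        rw [← hcg] at h1
        refine (ENNReal.rpow_le_rpow h1 he).trans (le_of_eq ?_)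
        rw [ENNReal.mul_rpow_of_nonneg _ _ he, ENNReal.mul_rpow_of_nonneg _ _ he,
          ← ENNReal.rpow_mul, show 2 * σ / (1 - σ) * ((1 - σ) / σ) = 2 by field_simp]
        norm_cast
    _ ≤ ∫⁻ t, (K ^ ((1 - σ) / σ) * Q ^ ((1 - σ) / σ)) * HM N g t ^ 2 :=
        setLIntegral_le_lintegral _ _
    _ = K ^ ((1 - σ) / σ) * (Q ^ ((1 - σ) / σ) * Q) := by
        rw [lintegral_const_mul _ (by fun_prop), mul_assoc]
    _ = K ^ ((1 - σ) / σ) * Q ^ (1 / σ) := by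
        congr 1
        nth_rw 2 [← ENNReal.rpow_one Q]
        rw [← ENNReal.rpow_add_of_nonneg _ _ he zero_le_one]
        congr 1
        field_simp
        ring
    _ ≤ K ^ ((1 - σ) / σ) * ((Real.toNNReal (512 * (κ⁻¹) ^ 2) : ℝ≥0∞) * HNorm σ c ^ (2 : ℝ)) ^ (1 / σ) := by
        gcongr
    _ = _ := by
        rw [ENNReal.mul_rpow_of_nonneg _ _ (by positivity), ← ENNReal.rpow_mul,
          show 2 * (1 / σ) = 2 / σ by ring, ← mul_assoc]
        push_cast [ENNReal.coe_rpow_of_nonneg _ he,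
          ENNReal.coe_rpow_of_nonneg _ (show 0 ≤ 1 / σ by positivity)]
        rfl


lemma measurable_vN (N : ℕ) (c : ℕ → ℂ) : Measurable (fun z : ℝ × E3 => vN N c z.1 z.2) := by
  unfold vN
  refine Finset.measurable_fun_sum _ fun n _ => ?_
  apply Measurable.mul
  · unfold Sc
    apply Continuous.measurable
    fun_prop
  · unfold eFun
    apply Complex.measurable_ofReal.comp
    apply Measurable.div
    · apply Continuous.measurable; fun_prop
    · apply Continuous.measurable; fun_prop

lemma vFun_le_liminf (c : ℕ → ℂ) (t : ℝ) (x : E3) (q : ℝ) (hq : 0 < q) :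
    ‖vFun (Sc t c) x‖ₑ ^ q ≤ Filter.liminf (fun N => ‖vN N c t x‖ₑ ^ q) Filter.atTop := by
  by_cases hS : Summable (fun n : ℕ => Sc t c n * (eFun (n + 1) x : ℂ))
  · have h1 := hS.hasSum.tendsto_sum_nat
    have h2 : Filter.Tendsto (fun N => ‖vN N c t x‖ₑ ^ q) Filter.atTop
        (nhds (‖vFun (Sc t c) x‖ₑ ^ q)) :=
      ((ENNReal.continuous_rpow_const (y := q)).tendsto _).comp
        ((continuous_enorm.tendsto _).comp h1)
    exact h2.liminf_eq.ge
  · have : vFun (Sc t c) x = 0 := tsum_eq_zero_of_not_summable hS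
    rw [this, enorm_zero, ENNReal.zero_rpow_of_pos hq]
    exact zero_le

instance : SFinite μΘ := by unfold μΘ; infer_instance

lemma full_est (σ : ℝ) (hσ0 : 0 < σ) (hσ1 : σ < 1) : ∃ C : ℝ≥0, ∀ (c : ℕ → ℂ) (T : ℝ),
    T ≤ 1 →
    ∫⁻ t in Ioo (-T) T, (∫⁻ x, ‖vFun (Sc t c) x‖ₑ ^ (2 / (1 - σ)) ∂μΘ) ^ ((1 - σ) / σ) ≤
      C * HNorm σ c ^ (2 / σ) := by
  obtain ⟨C, hC⟩ := finite_est σ hσ0 hσ1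
  have hs : 0 < 1 - σ := by linarith
  have hq0 : 0 < 2 / (1 - σ) := by positivity
  have he : 0 < (1 - σ) / σ := by positivity
  refine ⟨C, fun c T hT => ?_⟩
  have hm : ∀ N, Measurable (fun z : ℝ × E3 => ‖vN N c z.1 z.2‖ₑ ^ (2 / (1 - σ))) :=
    fun N => (measurable_vN N c).enorm.pow_const _
  have hm' : ∀ t N, Measurable (fun x : E3 => ‖vN N c t x‖ₑ ^ (2 / (1 - σ))) := by
    intro t N
    have h := (measurable_vN N c).comp (measurable_prodMk_left (x := t))
    exact h.enorm.pow_const _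
  have hm2 : ∀ N, Measurable
      (fun t => (∫⁻ x, ‖vN N c t x‖ₑ ^ (2 / (1 - σ)) ∂μΘ) ^ ((1 - σ) / σ)) := by
    intro N
    have h := Measurable.lintegral_prod_right' (ν := μΘ) (hm N)
    exact h.pow_const _
  have h1 : ∀ t, (∫⁻ x, ‖vFun (Sc t c) x‖ₑ ^ (2 / (1 - σ)) ∂μΘ) ^ ((1 - σ) / σ) ≤
      Filter.liminf (fun N => (∫⁻ x, ‖vN N c t x‖ₑ ^ (2 / (1 - σ)) ∂μΘ) ^ ((1 - σ) / σ))
        Filter.atTop := by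
    intro t
    have h2 : ∫⁻ x, ‖vFun (Sc t c) x‖ₑ ^ (2 / (1 - σ)) ∂μΘ ≤
        Filter.liminf (fun N => ∫⁻ x, ‖vN N c t x‖ₑ ^ (2 / (1 - σ)) ∂μΘ) Filter.atTop :=
      (lintegral_mono fun x => vFun_le_liminf c t x _ hq0).trans
        (lintegral_liminf_le (hm' t))
    refine (ENNReal.rpow_le_rpow h2 he.le).trans (le_of_eq ?_)
    exact (ENNReal.monotone_rpow_of_nonneg he.le).map_liminf_of_continuousAt _
      (ENNReal.continuous_rpow_const.continuousAt)
  refine (lintegral_mono h1).trans ((lintegral_liminf_le hm2).trans ?_)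
  refine (Filter.liminf_le_liminf (Filter.Eventually.of_forall fun N => hC N c T hT)).trans ?_
  rw [Filter.liminf_const]

lemma mixed_est (σ : ℝ) (hσ0 : 0 < σ) (hσ1 : σ < 1) : ∃ C : ℝ≥0, ∀ (c : ℕ → ℂ) (T : ℝ),
    T ≤ 1 → mixedNorm (pSig σ) (qSig σ) T (fun t => vFun (Sc t c)) ≤ C * HNorm σ c := by
  obtain ⟨C, hC⟩ := full_est σ hσ0 hσ1
  have hs : 0 < 1 - σ := by linarith
  have hq0 : 0 < 2 / (1 - σ) := by positivity
  have hp0 : 0 < 2 / σ := by positivity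
  refine ⟨C ^ (σ / 2), fun c T hT => ?_⟩
  unfold mixedNorm pSig qSig
  rw [eLpNorm_eq_lintegral_rpow_enorm_toReal (by simpa using hp0) ENNReal.ofReal_ne_top,
    ENNReal.toReal_ofReal hp0.le]
  have h1 : ∀ t, ‖(eLpNorm (vFun (Sc t c)) (ENNReal.ofReal (2 / (1 - σ))) μΘ).toReal‖ₑ ^ (2 / σ) ≤
      (∫⁻ x, ‖vFun (Sc t c) x‖ₑ ^ (2 / (1 - σ)) ∂μΘ) ^ ((1 - σ) / σ) := by
    intro t
    rw [Real.enorm_eq_ofReal ENNReal.toReal_nonneg]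
    refine (ENNReal.rpow_le_rpow ENNReal.ofReal_toReal_le hp0.le).trans (le_of_eq ?_)
    rw [eLpNorm_eq_lintegral_rpow_enorm_toReal (by simpa using hq0) ENNReal.ofReal_ne_top,
      ENNReal.toReal_ofReal hq0.le, ← ENNReal.rpow_mul]
    congr 1
    field_simp
  refine (ENNReal.rpow_le_rpow ((lintegral_mono h1).trans (hC c T hT)) (by positivity)).trans
    (le_of_eq ?_)
  rw [ENNReal.mul_rpow_of_nonneg _ _ (by positivity), ← ENNReal.rpow_mul,
    show 2 / σ * (1 / (2 / σ)) = 1 by field_simp, ENNReal.rpow_one,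
    show 1 / (2 / σ) = σ / 2 by field_simp, ENNReal.coe_rpow_of_nonneg _ (by positivity)]

lemma HNorm_Sc (σ t : ℝ) (c : ℕ → ℂ) : HNorm σ (Sc t c) = HNorm σ c := by
  unfold HNorm
  have : ∀ n, ‖Sc t c n‖₊ = ‖c n‖₊ := by
    intro n
    unfold Sc
    rw [nnnorm_mul]
    have : ‖Complex.exp (-(Real.pi * (n + 1) * t) * Complex.I)‖₊ = 1 := by
      apply NNReal.eq
      have := Complex.norm_exp_ofReal_mul_I (-(Real.pi * (n + 1) * t))
      push_cast at this
      simpa using this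
    rw [this, one_mul]
  simp only [this]

/-- homogeneous Strichartz estimate `‖S(·)f‖_{X^σ_T} ≤ C ‖f‖_{H^σ(Θ)}`
for `T ∈ (0,1]`, and in particular the `L^{p_σ}((-T,T);L^{q_σ}(Θ))` bound. -/
theorem stmt10 (σ : ℝ) (hσ0 : 0 < σ) (hσ1 : σ < 1) :
    ∃ C : ℝ, 0 < C ∧ ∀ T : ℝ, 0 < T → T ≤ 1 → ∀ c : ℕ → ℂ, HNorm σ c < ⊤ →
      XNorm σ T (fun t => Sc t c) ≤ ENNReal.ofReal C * HNorm σ c ∧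
      mixedNorm (pSig σ) (qSig σ) T (fun t => vFun (Sc t c))
        ≤ ENNReal.ofReal C * HNorm σ c := by
  obtain ⟨C, hC⟩ := mixed_est σ hσ0 hσ1
  refine ⟨1 + C, by positivity, fun T _ hT c _ => ?_⟩
  have h1 : ENNReal.ofReal (1 + C) * HNorm σ c = HNorm σ c + C * HNorm σ c := by
    rw [ENNReal.ofReal_add zero_le_one C.coe_nonneg, ENNReal.ofReal_one, ENNReal.ofReal_coe_nnreal,
      add_mul, one_mul]
  rw [h1]
  refine ⟨?_, (hC c T hT).trans le_add_self⟩
  unfold XNorm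
  refine add_le_add ?_ (hC c T hT)
  exact iSup₂_le fun t _ => (HNorm_Sc σ t c).le

end
end

section
/- Let 4 < p < 6 and set σ = 3/2 − 4/p. There exists a constant C > 0 such that for every T ∈ (0,1] and every radial f ∈ H^σ(Θ), ‖S(t)f‖_{L^p((−T,T) × Θ)} ≤ C ‖f‖_{H^σ(Θ)}, where the L^p norm is taken with respect to the product Lebesgue measure on (−T,T) × Θ. -/
open MeasureTheory Set ENNReal NNReal

noncomputable section

lemma J_aux (a : ℝ) (h1 : 1 < a) (h3 : a < 3) (s : ℝ) (hs : 0 < s) :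
    IntegrableOn (fun y : ℝ => y ^ (-a) * (min 1 (y * s)) ^ 2) (Ioi 0) ∧
    ∫ y in Ioi (0:ℝ), y ^ (-a) * (min 1 (y * s)) ^ 2 = (1 / (3 - a) + 1 / (a - 1)) * s ^ (a - 1) := by
  have hsi : 0 < s⁻¹ := inv_pos.2 hs
  have e1 : EqOn (fun y : ℝ => y ^ (-a) * (min 1 (y * s)) ^ 2) (fun y => s ^ 2 * y ^ (2 - a)) (Ioc 0 s⁻¹) := by
    intro y hy
    have hy1 : y * s ≤ 1 := by
      have := mul_le_mul_of_nonneg_right hy.2 hs.le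
      rwa [inv_mul_cancel₀ hs.ne'] at this
    have : y ^ (2 - a) = y ^ (-a) * y ^ 2 := by
      rw [sub_eq_add_neg, add_comm, Real.rpow_add hy.1]; simp
    simp only [min_eq_right hy1, this]; ring
  have e2 : EqOn (fun y : ℝ => y ^ (-a) * (min 1 (y * s)) ^ 2) (fun y => y ^ (-a)) (Ioi s⁻¹) := by
    intro y hy
    have hy1 : 1 ≤ y * s := by
      have := mul_le_mul_of_nonneg_right (le_of_lt (show s⁻¹ < y from hy)) hs.le
      rwa [inv_mul_cancel₀ hs.ne'] at this
    simp [min_eq_left hy1]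
  have i1' : IntegrableOn (fun y : ℝ => s ^ 2 * y ^ (2 - a)) (Ioc 0 s⁻¹) := by
    have := (intervalIntegral.intervalIntegrable_rpow' (a := 0) (b := s⁻¹) (r := 2 - a) (by linarith)).1
    exact this.const_mul _
  have i2' := integrableOn_Ioi_rpow_of_lt (a := -a) (by linarith) hsi
  have i1 := i1'.congr_fun e1.symm measurableSet_Ioc
  have i2 := i2'.congr_fun e2.symm measurableSet_Ioi
  have hu : Ioi (0:ℝ) = Ioc 0 s⁻¹ ∪ Ioi s⁻¹ := (Ioc_union_Ioi_eq_Ioi hsi.le).symm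
  refine ⟨hu ▸ i1.union i2, ?_⟩
  rw [hu, setIntegral_union (Ioc_disjoint_Ioi le_rfl) measurableSet_Ioi i1 i2,
    setIntegral_congr_fun measurableSet_Ioc e1, setIntegral_congr_fun measurableSet_Ioi e2,
    integral_Ioi_rpow_of_lt (by linarith) hsi, integral_const_mul,
    ← intervalIntegral.integral_of_le hsi.le, integral_rpow (Or.inl (by linarith))]
  have q1 : s⁻¹ ^ (2 - a + 1) = s ^ (a - 1) / s ^ 2 := by
    rw [Real.inv_rpow hs.le, ← Real.rpow_neg hs.le, ← Real.rpow_natCast s 2, ← Real.rpow_sub hs]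
    congr 1; push_cast; ring
  have q2 : s⁻¹ ^ (-a + 1) = s ^ (a - 1) := by
    rw [Real.inv_rpow hs.le, ← Real.rpow_neg hs.le]
    congr 1; ring
  rw [q1, q2, Real.zero_rpow (by linarith)]
  have : 3 - a ≠ 0 := by linarith
  have : a - 1 ≠ 0 := by linarith
  have : 2 - a + 1 ≠ 0 := by linarith
  have : -a + 1 ≠ 0 := by linarith
  have z1 : 2 - a + 1 = 3 - a := by ring
  have z2 : -a + 1 = -(a - 1) := by ring
  rw [z1, z2, neg_div_neg_eq]
  field_simp
  ring

lemma J_lint (a : ℝ) (h1 : 1 < a) (h3 : a < 3) (s : ℝ) (hs : 0 < s) :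
    ∫⁻ y in Ioi (0:ℝ), ENNReal.ofReal (y ^ (-a) * (min 1 (y * s)) ^ 2)
      = ENNReal.ofReal ((1 / (3 - a) + 1 / (a - 1)) * s ^ (a - 1)) := by
  obtain ⟨i, e⟩ := J_aux a h1 h3 s hs
  rw [← e, ofReal_integral_eq_lintegral_ofReal i]
  filter_upwards [ae_restrict_mem measurableSet_Ioi] with y hy
  have : 0 < y := hy
  simp only [Pi.zero_apply]
  positivity

lemma L1_aux (a : ℝ) (h1 : 1 < a) (h3 : a < 3) (s : ℝ) (hs : 0 < s) :
    ∑' n : ℕ, ENNReal.ofReal ((Real.pi * (n + 1)) ^ (-a) * (min 1 (Real.pi * (n + 1) * s)) ^ 2)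
      ≤ ENNReal.ofReal (2 ^ a) * ENNReal.ofReal ((1 / (3 - a) + 1 / (a - 1)) * s ^ (a - 1)) := by
  set w : ℕ → ℝ := fun n => Real.pi * (n + 1) with hw
  have wpos : ∀ n, 0 < w n := fun n => by have := Real.pi_pos; simp only [hw]; positivity
  have wsucc : ∀ n, w (n + 1) = w n + Real.pi := fun n => by simp only [hw]; push_cast; ring
  have wpi : ∀ n, Real.pi ≤ w n := fun n => by
    have := Real.pi_pos
    simp only [hw]; nlinarith [(Nat.cast_nonneg n : (0:ℝ) ≤ n)]
  have wm : Monotone w := monotone_nat_of_le_succ fun n => by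
    rw [wsucc]; linarith [Real.pi_pos]
  set g : ℝ → ℝ≥0∞ := fun y => ENNReal.ofReal (y ^ (-a) * (min 1 (y * s)) ^ 2) with hg
  have key : ∀ n, ENNReal.ofReal ((w n) ^ (-a) * (min 1 (w n * s)) ^ 2) ≤
      ∫⁻ y in Ioc (w n) (w (n+1)), ENNReal.ofReal (2 ^ a) * g y := by
    intro n
    have hvol : 1 ≤ volume (Ioc (w n) (w (n+1))) := by
      rw [Real.volume_Ioc, wsucc, add_sub_cancel_left, ENNReal.one_le_ofReal]
      linarith [Real.pi_gt_three]
    calc _ ≤ ENNReal.ofReal ((w n) ^ (-a) * (min 1 (w n * s)) ^ 2) * volume (Ioc (w n) (w (n+1))) :=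
          le_mul_of_one_le_right zero_le hvol
      _ = ∫⁻ y in Ioc (w n) (w (n+1)), ENNReal.ofReal ((w n) ^ (-a) * (min 1 (w n * s)) ^ 2) := by
          rw [setLIntegral_const]
      _ ≤ _ := by
          refine setLIntegral_mono' measurableSet_Ioc fun y hy => ?_
          rw [hg, ← ENNReal.ofReal_mul (by positivity)]
          apply ENNReal.ofReal_le_ofReal
          have hwn := wpos n
          have hy0 : 0 < y := hwn.trans hy.1
          have hy2 : y ≤ 2 * w n := by
            have := hy.2; rw [wsucc] at this; linarith [wpi n]
          rw [← mul_assoc]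
          have b1 : w n ^ (-a) ≤ 2 ^ a * y ^ (-a) := by
            have : (2 * w n) ^ (-a) ≤ y ^ (-a) :=
              Real.rpow_le_rpow_of_nonpos hy0 hy2 (by linarith)
            rw [Real.mul_rpow (by norm_num) hwn.le, Real.rpow_neg (by norm_num)] at this
            have h2 : (0:ℝ) < 2 ^ a := by positivity
            calc w n ^ (-a) = 2 ^ a * ((2 ^ a)⁻¹ * w n ^ (-a)) := by field_simp
              _ ≤ _ := by gcongr
          have b2 : min 1 (w n * s) ≤ min 1 (y * s) := by
            have := hy.1.le
            gcongr
          have b3 : 0 ≤ min 1 (w n * s) := by positivity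
          gcongr
  calc _ ≤ ∑' n, ∫⁻ y in Ioc (w n) (w (n+1)), ENNReal.ofReal (2 ^ a) * g y :=
        ENNReal.tsum_le_tsum key
    _ = ∫⁻ y in ⋃ n, Ioc (w n) (w (n+1)), ENNReal.ofReal (2 ^ a) * g y := by
        rw [lintegral_iUnion (fun _ => measurableSet_Ioc)]
        simpa using wm.pairwise_disjoint_on_Ioc_succ
    _ ≤ ∫⁻ y in Ioi 0, ENNReal.ofReal (2 ^ a) * g y := by
        apply lintegral_mono_set
        intro y hy
        obtain ⟨n, hn⟩ := mem_iUnion.1 hy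
        exact (wpos n).trans hn.1
    _ = _ := by
        rw [lintegral_const_mul' _ _ ENNReal.ofReal_ne_top, J_lint a h1 h3 s hs]

lemma L2_aux (σ : ℝ) (h1 : 1 < 2 * σ) (h3 : 2 * σ < 3) : ∃ K : ℝ, 0 < K ∧
    ∀ (c : ℕ → ℂ) (r : ℝ), 0 < r →
    ∑' n : ℕ, ‖c n‖ₑ * ENNReal.ofReal (min 1 (Real.pi * (n + 1) * r))
      ≤ ENNReal.ofReal (K * r ^ (σ - 1/2)) * HNorm σ c := by
  set K0 : ℝ := 2 ^ (2 * σ) * (1 / (3 - 2 * σ) + 1 / (2 * σ - 1)) with hK0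
  have hK0p : 0 < K0 := by
    have : 0 < 3 - 2 * σ := by linarith
    have : 0 < 2 * σ - 1 := by linarith
    positivity
  refine ⟨K0 ^ (1/2 : ℝ), by positivity, fun c r hr => ?_⟩
  have wpos : ∀ n : ℕ, 0 < Real.pi * ((n:ℝ) + 1) := fun n => by have := Real.pi_pos; positivity
  have hH := ENNReal.lintegral_mul_le_Lp_mul_Lq (Measure.count : Measure ℕ)
    (p := 2) (q := 2) (Real.HolderConjugate.two_two)
    (f := fun n => ENNReal.ofReal ((Real.pi * (n + 1)) ^ (-σ) * min 1 (Real.pi * (n + 1) * r)))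
    (g := fun n => ENNReal.ofReal ((Real.pi * (n + 1)) ^ σ) * ‖c n‖ₑ)
    (measurable_of_countable _).aemeasurable (measurable_of_countable _).aemeasurable
  simp only [lintegral_count] at hH
  have e1 : ∀ n : ℕ, ENNReal.ofReal ((Real.pi * (n + 1)) ^ (-σ) * min 1 (Real.pi * (n + 1) * r)) ^ (2:ℝ)
      = ENNReal.ofReal ((Real.pi * (n + 1)) ^ (-(2 * σ)) * (min 1 (Real.pi * (n + 1) * r)) ^ 2) := by
    intro n
    have := wpos n
    rw [ENNReal.ofReal_rpow_of_nonneg (by positivity) (by norm_num), Real.rpow_two, mul_pow,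
      ← Real.rpow_natCast _ 2, ← Real.rpow_mul this.le]
    congr 3; push_cast; ring
  have e2 : ∀ n : ℕ, (ENNReal.ofReal ((Real.pi * (n + 1)) ^ σ) * ‖c n‖ₑ) ^ (2:ℝ)
      = ENNReal.ofReal ((Real.pi * (n + 1)) ^ (2 * σ)) * (‖c n‖₊ : ℝ≥0∞) ^ 2 := by
    intro n
    have := wpos n
    rw [ENNReal.mul_rpow_of_nonneg _ _ (by norm_num),
      ENNReal.ofReal_rpow_of_nonneg (by positivity) (by norm_num), ← Real.rpow_mul this.le,
      mul_comm σ 2]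
    congr 1
    exact ENNReal.rpow_two _
  simp only [e1, e2, Pi.mul_apply] at hH
  refine (le_of_eq ?_).trans (hH.trans ?_)
  · congr 1; ext n
    have := wpos n
    rw [← mul_assoc, ← ENNReal.ofReal_mul (by positivity), mul_comm]
    congr 2
    rw [Real.rpow_neg this.le]
    have h2 : 0 < (Real.pi * ((n:ℝ) + 1)) ^ σ := by positivity
    field_simp
  · unfold HNorm
    gcongr
    refine (ENNReal.rpow_le_rpow (L1_aux (2 * σ) h1 h3 r hr) (by norm_num)).trans (le_of_eq ?_)
    rw [← ENNReal.ofReal_mul (by positivity), ← mul_assoc, ← hK0,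
      ENNReal.ofReal_rpow_of_nonneg (by positivity) (by norm_num),
      Real.mul_rpow hK0p.le (by positivity), ← Real.rpow_mul hr.le]
    congr 3; ring

lemma L3_aux (σ : ℝ) (h0 : 0 < σ) (h1 : σ < 1) : ∃ K : ℝ, 0 < K ∧ ∀ s : ℝ, 0 < s →
    ∫⁻ x : E3, ENNReal.ofReal (‖x‖ ^ (-3 - 2 * σ) * (min 1 (s * ‖x‖)) ^ 2)
      ≤ ENNReal.ofReal (K * s ^ (2 * σ)) := by
  set V := (volume : Measure E3).real (Metric.ball 0 1) with hV
  have hVp : 0 ≤ V := measureReal_nonneg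
  set K0 := (1 / (3 - (1 + 2 * σ)) + 1 / (1 + 2 * σ - 1)) with hK0
  have hK0p : 0 < K0 := by
    have : 0 < 3 - (1 + 2 * σ) := by linarith
    have : 0 < 1 + 2 * σ - 1 := by linarith
    positivity
  refine ⟨3 * (V + 1) * K0, by positivity, fun s hs => ?_⟩
  obtain ⟨i, e⟩ := J_aux (1 + 2 * σ) (by linarith) (by linarith) s hs
  set f : ℝ → ℝ := fun y => y ^ (-3 - 2 * σ) * (min 1 (s * y)) ^ 2 with hf
  have eq : EqOn (fun y : ℝ => y ^ (-(1 + 2 * σ)) * (min 1 (y * s)) ^ 2)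
      (fun y => y ^ (Module.finrank ℝ E3 - 1) • f y) (Ioi 0) := by
    intro y hy
    have hy' : 0 < y := hy
    simp only [hf, finrank_euclideanSpace, Fintype.card_fin, smul_eq_mul, ← mul_assoc]
    rw [mul_comm s y]
    congr 1
    rw [← Real.rpow_natCast, ← Real.rpow_add hy']
    congr 1; push_cast; ring
  have i' := (integrable_fun_norm_addHaar (volume : Measure E3) (f := f)).2
    (i.congr_fun eq measurableSet_Ioi)
  have := integral_fun_norm_addHaar (volume : Measure E3) f
  rw [← setIntegral_congr_fun measurableSet_Ioi eq, e] at this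
  rw [← ofReal_integral_eq_lintegral_ofReal i' (Filter.Eventually.of_forall fun x => by
    simp only [hf, Pi.zero_apply]; positivity)]
  apply ENNReal.ofReal_le_ofReal
  rw [this, ← hV]
  simp only [finrank_euclideanSpace, Fintype.card_fin, nsmul_eq_mul, smul_eq_mul, Nat.cast_ofNat]
  rw [add_sub_cancel_left, ← mul_assoc, ← mul_assoc]
  rw [add_sub_cancel_left] at hK0
  rw [← hK0]
  gcongr
  linarith

lemma ortho_aux (k : ℤ) : ∫ t in (-1:ℝ)..1, Complex.exp ((Real.pi * k * Complex.I) * t)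
    = if k = 0 then 2 else 0 := by
  split_ifs with h
  · subst h; norm_num
  · have hc : ((Real.pi:ℂ) * k * Complex.I) ≠ 0 := by
      simp [Real.pi_ne_zero, h]
    rw [integral_exp_mul_complex hc]
    have : Complex.exp ((Real.pi:ℂ) * k * Complex.I * (1:ℝ)) =
        Complex.exp ((Real.pi:ℂ) * k * Complex.I * (-1:ℝ)) := by
      rw [Complex.exp_eq_exp_iff_exists_int]
      exact ⟨k, by push_cast; ring⟩
    rw [this]; simp

lemma parseval_fin (a : ℕ → ℂ) (N : ℕ) :
    ∫ t in (-1:ℝ)..1, ‖∑ n ∈ Finset.range N, Complex.exp (-(Real.pi * (n + 1) * t) * Complex.I) * a n‖ ^ 2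
      = 2 * ∑ n ∈ Finset.range N, ‖a n‖ ^ 2 := by
  have : ∀ t : ℝ, ((‖∑ n ∈ Finset.range N,
      Complex.exp (-(Real.pi * (n + 1) * t) * Complex.I) * a n‖ ^ 2 : ℝ) : ℂ) =
      ∑ n ∈ Finset.range N, ∑ m ∈ Finset.range N,
        (a n * (starRingEnd ℂ) (a m)) * Complex.exp ((Real.pi * ((m - n : ℤ) : ℂ) * Complex.I) * t) := by
    intro t
    rw [Complex.ofReal_pow, ← Complex.mul_conj', map_sum, Finset.sum_mul_sum]
    refine Finset.sum_congr rfl fun n _ => Finset.sum_congr rfl fun m _ => ?_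
    rw [map_mul, ← Complex.exp_conj]
    simp only [map_mul, map_neg, map_add, Complex.conj_ofReal, Complex.conj_I, map_one, map_natCast]
    rw [mul_mul_mul_comm, ← Complex.exp_add, mul_comm]
    congr 2; push_cast; ring
  have hR : ((2 * ∑ n ∈ Finset.range N, ‖a n‖ ^ 2 : ℝ) : ℂ) =
      ∑ n ∈ Finset.range N, 2 * (‖a n‖ : ℂ) ^ 2 := by
    push_cast; rw [Finset.mul_sum]
  apply Complex.ofReal_injective
  rw [← intervalIntegral.integral_ofReal]
  simp only [this]
  rw [intervalIntegral.integral_finsetSum (fun n _ => by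
    apply Continuous.intervalIntegrable; fun_prop)]
  rw [hR]
  refine Finset.sum_congr rfl fun n hn => ?_
  rw [intervalIntegral.integral_finsetSum (fun n _ => by
    apply Continuous.intervalIntegrable; fun_prop)]
  simp only [intervalIntegral.integral_const_mul]
  rw [Finset.sum_eq_single_of_mem n hn]
  · rw [ortho_aux]; simp [Complex.mul_conj', mul_comm]
  · intro m _ hm
    rw [ortho_aux, if_neg (by omega), mul_zero]

lemma parseval (a : ℕ → ℂ) (ha : Summable (fun n => ‖a n‖)) :
    ∫⁻ t in Ioo (-1:ℝ) 1, ‖∑' n : ℕ, Complex.exp (-(Real.pi * (n + 1) * t) * Complex.I) * a n‖ₑ ^ 2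
      ≤ 2 * ∑' n, ‖a n‖ₑ ^ 2 := by
  have hlim : ∀ t : ℝ, Filter.Tendsto (fun N => ‖∑ n ∈ Finset.range N,
      Complex.exp (-(Real.pi * (n + 1) * t) * Complex.I) * a n‖ₑ ^ 2) Filter.atTop
      (nhds (‖∑' n : ℕ, Complex.exp (-(Real.pi * (n + 1) * t) * Complex.I) * a n‖ₑ ^ 2)) := by
    intro t
    have hs : Summable (fun n : ℕ => Complex.exp (-(Real.pi * (n + 1) * t) * Complex.I) * a n) := by
      refine Summable.of_norm (ha.congr fun n => ?_)
      rw [norm_mul, Complex.norm_exp]; simp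
    have h1 := hs.hasSum.tendsto_sum_nat
    exact ((ENNReal.continuous_pow 2).comp continuous_enorm).continuousAt.tendsto.comp h1
  calc _ = ∫⁻ t in Ioo (-1:ℝ) 1, Filter.liminf (fun N => ‖∑ n ∈ Finset.range N,
      Complex.exp (-(Real.pi * (n + 1) * t) * Complex.I) * a n‖ₑ ^ 2) Filter.atTop := by
        refine lintegral_congr fun t => (hlim t).liminf_eq.symm
    _ ≤ Filter.liminf (fun N => ∫⁻ t in Ioo (-1:ℝ) 1, ‖∑ n ∈ Finset.range N,
      Complex.exp (-(Real.pi * (n + 1) * t) * Complex.I) * a n‖ₑ ^ 2) Filter.atTop := by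
        refine lintegral_liminf_le fun N => ?_
        have : Continuous (fun t : ℝ => ∑ n ∈ Finset.range N,
          Complex.exp (-(Real.pi * (n + 1) * t) * Complex.I) * a n) := by fun_prop
        exact this.measurable.enorm.pow_const 2
    _ ≤ _ := by
        refine Filter.liminf_le_of_le (by isBoundedDefault) fun b hb => ?_
        obtain ⟨N, hN⟩ := hb.exists
        refine hN.trans ?_
        have hc : Continuous (fun t : ℝ => ‖∑ n ∈ Finset.range N,
          Complex.exp (-(Real.pi * (n + 1) * t) * Complex.I) * a n‖ ^ 2) := by fun_prop
        have h1 : ∫⁻ t in Ioo (-1:ℝ) 1, ‖∑ n ∈ Finset.range N,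
            Complex.exp (-(Real.pi * (n + 1) * t) * Complex.I) * a n‖ₑ ^ 2
            = ENNReal.ofReal (2 * ∑ n ∈ Finset.range N, ‖a n‖ ^ 2) := by
          rw [← parseval_fin, intervalIntegral.integral_of_le (by norm_num),
            ofReal_integral_eq_lintegral_ofReal
              ((hc.intervalIntegrable (μ := volume) (-1) 1).1)
              (Filter.Eventually.of_forall fun t => by simp only [Pi.zero_apply]; positivity),
            Measure.restrict_congr_set Ioo_ae_eq_Ioc]
          refine lintegral_congr fun t => ?_
          rw [ENNReal.ofReal_pow (norm_nonneg _), ofReal_norm]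
        rw [h1, ENNReal.ofReal_mul (by norm_num), ENNReal.ofReal_sum_of_nonneg (fun _ _ => by positivity)]
        simp only [ENNReal.ofReal_ofNat]
        gcongr
        refine le_trans (le_of_eq ?_) (ENNReal.sum_le_tsum (Finset.range N))
        refine Finset.sum_congr rfl fun n _ => ?_
        rw [ENNReal.ofReal_pow (norm_nonneg _), ofReal_norm]

/-- The numerator `∑ e^{-iπnt} c_n sin(nπr)`. -/
def Gnum (c : ℕ → ℂ) (t r : ℝ) : ℂ :=
  ∑' n : ℕ, Complex.exp (-(Real.pi * (n + 1) * t) * Complex.I) *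
    (c n * (Real.sin (Real.pi * (n + 1) * r) : ℝ))

lemma vFun_eq (c : ℕ → ℂ) (t : ℝ) (x : E3) :
    vFun (Sc t c) x = Gnum c t ‖x‖ / ((Real.sqrt (2 * Real.pi) * ‖x‖ : ℝ) : ℂ) := by
  unfold vFun Gnum Sc eFun
  rw [← tsum_div_const]
  congr 1; ext n
  rw [Complex.ofReal_div, mul_div_assoc, mul_div_assoc, mul_assoc]
  congr 5
  push_cast; ring

lemma sin_le_min (w r : ℝ) (hw : 0 ≤ w) (hr : 0 ≤ r) : |Real.sin (w * r)| ≤ min 1 (w * r) := by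
  refine le_min (Real.abs_sin_le_one _) ?_
  have := Real.abs_sin_le_abs (x := w * r)
  rwa [abs_of_nonneg (mul_nonneg hw hr)] at this

lemma norm_exp_one (n : ℕ) (t : ℝ) :
    ‖Complex.exp (-(Real.pi * (n + 1) * t) * Complex.I)‖ = 1 := by
  rw [Complex.norm_exp]; simp

lemma enorm_coef_le (c : ℕ → ℂ) (n : ℕ) (r : ℝ) (hr : 0 ≤ r) :
    ‖c n * (Real.sin (Real.pi * (n + 1) * r) : ℝ)‖ₑ
      ≤ ‖c n‖ₑ * ENNReal.ofReal (min 1 (Real.pi * (n + 1) * r)) := by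
  rw [enorm_mul]
  gcongr
  rw [← ofReal_norm, Complex.norm_real, Real.norm_eq_abs]
  have := Real.pi_pos
  exact ENNReal.ofReal_le_ofReal (sin_le_min _ _ (by positivity) hr)

lemma Gnum_le (c : ℕ → ℂ) (t r : ℝ) (hr : 0 ≤ r) :
    ‖Gnum c t r‖ₑ ≤ ∑' n : ℕ, ‖c n‖ₑ * ENNReal.ofReal (min 1 (Real.pi * (n + 1) * r)) := by
  refine enorm_tsum_le_tsum_enorm.trans (ENNReal.tsum_le_tsum fun n => ?_)
  rw [enorm_mul, ← ofReal_norm (Complex.exp _), norm_exp_one, ENNReal.ofReal_one, one_mul]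
  exact enorm_coef_le c n r hr

lemma Gnum_cont (c : ℕ → ℂ) (hc : Summable (fun n => ‖c n‖)) :
    Continuous (fun z : ℝ × ℝ => Gnum c z.1 z.2) := by
  refine continuous_tsum (fun n => by fun_prop) hc fun n z => ?_
  rw [norm_mul, norm_exp_one, one_mul, norm_mul, Complex.norm_real, Real.norm_eq_abs]
  exact mul_le_of_le_one_right (norm_nonneg _) (Real.abs_sin_le_one _)

lemma Gnum_L2 (c : ℕ → ℂ) (hc : Summable (fun n => ‖c n‖)) (r : ℝ) (hr : 0 ≤ r) :
    ∫⁻ t in Ioo (-1:ℝ) 1, ‖Gnum c t r‖ₑ ^ 2 ≤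
      2 * ∑' n : ℕ, ‖c n‖ₑ ^ 2 * ENNReal.ofReal ((min 1 (Real.pi * (n + 1) * r)) ^ 2) := by
  refine (parseval _ ?_).trans ?_
  · refine Summable.of_nonneg_of_le (fun _ => norm_nonneg _) (fun n => ?_) hc
    rw [norm_mul, Complex.norm_real, Real.norm_eq_abs]
    exact mul_le_of_le_one_right (norm_nonneg _) (Real.abs_sin_le_one _)
  · gcongr with n
    have := Real.pi_pos
    rw [ENNReal.ofReal_pow (by positivity), ← mul_pow]
    gcongr
    exact enorm_coef_le c n r hr

lemma summable_of_H (σ : ℝ) (h1 : 1 < 2 * σ) (h3 : 2 * σ < 3) (c : ℕ → ℂ)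
    (hc : HNorm σ c < ⊤) : Summable (fun n => ‖c n‖) := by
  obtain ⟨K, hK, h⟩ := L2_aux σ h1 h3
  have h2 := h c 1 one_pos
  have h3 : ∑' n, ((‖c n‖₊ : ℝ≥0) : ℝ≥0∞) ≠ ⊤ := by
    refine ((lt_of_le_of_lt (le_trans (ENNReal.tsum_le_tsum fun n => ?_) h2)
      (ENNReal.mul_lt_top ENNReal.ofReal_lt_top hc))).ne
    rw [min_eq_left, ENNReal.ofReal_one, mul_one]
    · exact le_rfl
    · have := Real.pi_gt_three
      nlinarith [(Nat.cast_nonneg n : (0:ℝ) ≤ n)]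
  have := ENNReal.tsum_coe_ne_top_iff_summable.1 h3
  exact NNReal.summable_coe.2 this

lemma expo_aux (p σ : ℝ) (hp : p ≠ 0) (hσ : σ = 3/2 - 4/p) :
    -p + (σ - 1/2) * (p - 2) = -3 - 2 * σ := by
  have : 4 / p * p = 4 := div_mul_cancel₀ 4 hp
  generalize 4 / p = q at *
  subst hσ
  linear_combination -this

set_option maxHeartbeats 2000000 in
/-- Pointwise-in-space bound for the time integral. -/
lemma time_bound (p σ K : ℝ) (hp4 : 4 < p) (hσ : σ = 3/2 - 4/p) (hK : 0 < K) (c : ℕ → ℂ)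
    (hc : Summable (fun n => ‖c n‖)) 
    (hA : ∀ r : ℝ, 0 < r →
      ∑' n : ℕ, ‖c n‖ₑ * ENNReal.ofReal (min 1 (Real.pi * (n + 1) * r))
        ≤ ENNReal.ofReal (K * r ^ (σ - 1/2)) * HNorm σ c) (x : E3) :
    ∫⁻ t in Ioo (-1:ℝ) 1, ‖vFun (Sc t c) x‖ₑ ^ p ≤
      (ENNReal.ofReal (K ^ (p - 2)) * HNorm σ c ^ (p - 2) * 2) *
        ∑' n : ℕ, ‖c n‖ₑ ^ 2 * 
          ENNReal.ofReal (‖x‖ ^ (-3 - 2 * σ) * (min 1 (Real.pi * (n + 1) * ‖x‖)) ^ 2) := by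
  rcases (norm_nonneg x).eq_or_lt with h0 | hr
  · have : ∀ t, ‖vFun (Sc t c) x‖ₑ ^ p = 0 := fun t => by
      rw [vFun_eq, ← h0]; simp [ENNReal.zero_rpow_of_pos (by linarith : 0 < p)]
    simp [this]
  set r := ‖x‖ with hrdef
  have hpt : ∀ t, ‖vFun (Sc t c) x‖ₑ ^ p ≤
      (ENNReal.ofReal (r ^ (-p)) * ENNReal.ofReal (K ^ (p - 2) * r ^ ((σ - 1/2) * (p - 2)))
        * HNorm σ c ^ (p - 2)) * ‖Gnum c t r‖ₑ ^ 2 := by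
    intro t
    have e0 : ‖vFun (Sc t c) x‖ₑ ≤ ENNReal.ofReal (r⁻¹) * ‖Gnum c t r‖ₑ := by
      rw [vFun_eq, ← ofReal_norm, ← ofReal_norm, norm_div, Complex.norm_real, Real.norm_eq_abs,
        ← ENNReal.ofReal_mul (by positivity)]
      apply ENNReal.ofReal_le_ofReal
      rw [abs_of_nonneg (by positivity), mul_comm r⁻¹, ← div_eq_mul_inv]
      have hs : 1 ≤ Real.sqrt (2 * Real.pi) := by
        rw [Real.one_le_sqrt]; linarith [Real.pi_gt_three]
      gcongr
      exact le_mul_of_one_le_left hr.le hs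
    have e1 : ‖Gnum c t r‖ₑ ^ p ≤ ENNReal.ofReal (K ^ (p - 2) * r ^ ((σ - 1/2) * (p - 2)))
        * HNorm σ c ^ (p - 2) * ‖Gnum c t r‖ₑ ^ 2 := by
      have : ‖Gnum c t r‖ₑ ^ p = ‖Gnum c t r‖ₑ ^ (p - 2) * ‖Gnum c t r‖ₑ ^ 2 := by
        rw [← ENNReal.rpow_two, ← ENNReal.rpow_add_of_nonneg _ _ (by linarith) (by norm_num)]
        congr 1; ring
      rw [this]
      gcongr
      refine (ENNReal.rpow_le_rpow ((Gnum_le c t r hr.le).trans (hA r hr)) (by linarith)).trans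
        (le_of_eq ?_)
      rw [ENNReal.mul_rpow_of_nonneg _ _ (by linarith),
        ENNReal.ofReal_rpow_of_nonneg (by positivity) (by linarith),
        Real.mul_rpow hK.le (by positivity), ← Real.rpow_mul hr.le]
    calc _ ≤ (ENNReal.ofReal (r⁻¹) * ‖Gnum c t r‖ₑ) ^ p := ENNReal.rpow_le_rpow e0 (by linarith)
      _ = ENNReal.ofReal (r ^ (-p)) * ‖Gnum c t r‖ₑ ^ p := by
        rw [ENNReal.mul_rpow_of_nonneg _ _ (by linarith),
          ENNReal.ofReal_rpow_of_nonneg (by positivity) (by linarith), Real.inv_rpow hr.le,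
          ← Real.rpow_neg hr.le]
      _ ≤ _ := by
        rw [mul_assoc, mul_assoc, ← mul_assoc (ENNReal.ofReal (K ^ (p - 2) * _))]
        gcongr
  have hGm : Measurable fun t => ‖Gnum c t r‖ₑ ^ 2 := by
    have : Continuous (fun t => Gnum c t r) :=
      (Gnum_cont c hc).comp (by fun_prop : Continuous fun t : ℝ => (t, r))
    exact this.measurable.enorm.pow_const 2
  refine (lintegral_mono hpt).trans ?_
  rw [lintegral_const_mul _ hGm]
  refine (mul_le_mul_right (Gnum_L2 c hc r hr.le) _).trans (le_of_eq ?_)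
  have hrr : r ^ (-p) * r ^ ((σ - 1/2) * (p - 2)) = r ^ (-3 - 2 * σ) := by
    rw [← Real.rpow_add hr]; congr 1
    exact expo_aux p σ (by linarith) hσ
  have hterm : ∀ n : ℕ, ‖c n‖ₑ ^ 2 *
      ENNReal.ofReal (r ^ (-3 - 2 * σ) * (min 1 (Real.pi * (n + 1) * r)) ^ 2) =
      ENNReal.ofReal (r ^ (-3 - 2 * σ)) *
        (‖c n‖ₑ ^ 2 * ENNReal.ofReal ((min 1 (Real.pi * (n + 1) * r)) ^ 2)) := by
    intro n
    rw [ENNReal.ofReal_mul (by positivity)]; ring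
  simp only [hterm]
  rw [ENNReal.tsum_mul_left, ← hrr, ENNReal.ofReal_mul (by positivity),
    ENNReal.ofReal_mul (by positivity)]
  ring

set_option maxHeartbeats 2000000 in
/-- the Strichartz estimate `‖S(t)f‖_{L^p((-T,T)×Θ)} ≤ C ‖f‖_{H^σ(Θ)}`
for `4 < p < 6`, `σ = 3/2 - 4/p`, `T ∈ (0,1]`. -/
theorem stmt13 (p : ℝ) (hp4 : 4 < p) (hp6 : p < 6) :
    ∃ C : ℝ, 0 < C ∧ ∀ T : ℝ, 0 < T → T ≤ 1 → ∀ c : ℕ → ℂ,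
      HNorm (3/2 - 4/p) c < ⊤ →
      stLp (ENNReal.ofReal p) (Set.Ioo (-T) T) (fun t x => vFun (Sc t c) x)
        ≤ ENNReal.ofReal C * HNorm (3/2 - 4/p) c := by
  have hp0 : 0 < p := by linarith
  have q1 : 4 / p < 1 := by rw [div_lt_one hp0]; exact hp4
  have q2 : 2 / 3 < 4 / p := by rw [lt_div_iff₀ hp0]; linarith
  obtain ⟨σ, hσ⟩ : ∃ σ : ℝ, σ = 3/2 - 4/p := ⟨_, rfl⟩
  rw [← hσ]
  obtain ⟨K1, hK1, hL2⟩ := L2_aux σ (by linarith) (by linarith)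
  obtain ⟨K2, hK2, hL3⟩ := L3_aux σ (by linarith) (by linarith)
  set M : ℝ := K1 ^ (p - 2) * 2 * K2 with hM
  have hMp : 0 < M := by positivity
  refine ⟨M ^ (1 / p), by positivity, fun T hT hT1 c hc => ?_⟩
  have hcs := summable_of_H σ (by linarith) (by linarith) c hc
  set H := HNorm σ c with hH
  have hH2 : ∑' n : ℕ, ENNReal.ofReal ((Real.pi * (n + 1)) ^ (2 * σ)) * (‖c n‖₊ : ℝ≥0∞) ^ 2
      = H ^ 2 := by
    rw [hH, HNorm, ← ENNReal.rpow_two, ← ENNReal.rpow_mul]; norm_num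
  have hmeas : Measurable (fun z : ℝ × E3 => ‖vFun (Sc z.1 c) z.2‖ₑ ^ p) := by
    simp only [vFun_eq]
    have h1 : Continuous (fun z : ℝ × E3 => Gnum c z.1 ‖z.2‖) :=
      (Gnum_cont c hcs).comp (by fun_prop : Continuous fun z : ℝ × E3 => (z.1, ‖z.2‖))
    have h2 : Continuous (fun z : ℝ × E3 => ((Real.sqrt (2 * Real.pi) * ‖z.2‖ : ℝ) : ℂ)) := by
      fun_prop
    exact (h1.measurable.div h2.measurable).enorm.pow_const p
  have hmono : stLp (ENNReal.ofReal p) (Set.Ioo (-T) T) (fun t x => vFun (Sc t c) x) ≤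
      stLp (ENNReal.ofReal p) (Set.Ioo (-1) 1) (fun t x => vFun (Sc t c) x) := by
    unfold stLp μΘ
    apply eLpNorm_mono_measure
    exact Measure.prod_mono (Measure.restrict_mono (Ioo_subset_Ioo (by linarith) hT1) le_rfl) le_rfl
  refine hmono.trans ?_
  unfold stLp
  rw [eLpNorm_eq_lintegral_rpow_enorm_toReal (by simpa using hp0) ENNReal.ofReal_ne_top,
    ENNReal.toReal_ofReal hp0.le]
  have main : ∫⁻ z : ℝ × E3, ‖vFun (Sc z.1 c) z.2‖ₑ ^ p
      ∂((volume.restrict (Ioo (-1:ℝ) 1)).prod μΘ) ≤ ENNReal.ofReal M * H ^ p := by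
    unfold μΘ
    rw [lintegral_prod_symm _ hmeas.aemeasurable]
    refine (lintegral_mono fun x => time_bound p σ K1 hp4 hσ hK1 c hcs (hL2 c) x).trans ?_
    refine (setLIntegral_le_lintegral _ _).trans ?_
    rw [lintegral_const_mul', lintegral_tsum]
    · have h1 : ∀ n : ℕ, ∫⁻ x : E3, ‖c n‖ₑ ^ 2 *
          ENNReal.ofReal (‖x‖ ^ (-3 - 2 * σ) * (min 1 (Real.pi * (n + 1) * ‖x‖)) ^ 2) ≤
          ENNReal.ofReal K2 * (ENNReal.ofReal ((Real.pi * (n + 1)) ^ (2 * σ)) * (‖c n‖₊ : ℝ≥0∞) ^ 2) := by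
        intro n
        have := Real.pi_pos
        rw [lintegral_const_mul' _ _ (by simp)]
        refine (mul_le_mul_right (hL3 (Real.pi * (n + 1)) (by positivity)) _).trans (le_of_eq ?_)
        rw [ENNReal.ofReal_mul hK2.le, mul_comm, mul_assoc]
        rfl
      refine (mul_le_mul_right (ENNReal.tsum_le_tsum h1) _).trans (le_of_eq ?_)
      rw [ENNReal.tsum_mul_left, hH2, hM, ENNReal.ofReal_mul (by positivity),
        ENNReal.ofReal_mul (by positivity)]
      have : H ^ p = H ^ (p - 2) * H ^ 2 := by
        rw [← ENNReal.rpow_two, ← ENNReal.rpow_add_of_nonneg _ _ (by linarith) (by norm_num)]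
        congr 1; ring
      rw [this, ENNReal.ofReal_ofNat]
      ring
    · intro n
      apply Measurable.aemeasurable
      fun_prop
    · refine ENNReal.mul_ne_top (ENNReal.mul_ne_top ENNReal.ofReal_ne_top ?_) (by simp)
      exact ENNReal.rpow_ne_top_of_nonneg (by linarith) hc.ne
  refine (ENNReal.rpow_le_rpow main (by positivity)).trans (le_of_eq ?_)
  rw [ENNReal.mul_rpow_of_nonneg _ _ (by positivity),
    ENNReal.ofReal_rpow_of_nonneg hMp.le (by positivity), ← ENNReal.rpow_mul,
    mul_one_div_cancel hp0.ne', ENNReal.rpow_one]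

end
end
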